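/- arXiv:2009.02804 — 6 statements merged into one kernel-verified Lean document; each statement's English description precedes it below -/
import Mathlib

section
/- Let a < b be real numbers, I = (a,b), I' = (0, b-a), let 0 < β, γ < 1 and 2 ≤ p < ∞, and let ϱ, ϑ ∈ L¹(I') satisfy the Sonin condition. If ψ, φ ∈ L_p(I,β,γ) satisfy ∫_a^x ϱ(x-t) ψ(t) dt = ∫_a^x ϱ(x-t) φ(t) dt for almost every x ∈ I, then ψ = φ almost everywhere on I. -/
open MeasureTheory Set Filter

/-- Normalizing constant of the orthonormal Jacobi polynomials. -/
noncomputable def jacobiDelta (a b β γ : ℝ) (n : ℕ) : ℝ :=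
  ((-1 : ℝ) ^ n / (b - a) ^ ((n : ℝ) + (β + γ + 1) / 2)) *
    Real.sqrt ((β + γ + 2 * n + 1) * Real.Gamma (β + γ + n + 1) /
      ((n.factorial : ℝ) * Real.Gamma (β + n + 1) * Real.Gamma (γ + n + 1)))

/-- Orthonormal Jacobi polynomial `p_n^{β,γ}` on `[a,b]`, given by the Rodrigues formula
(expanded via the Leibniz rule into a genuine polynomial expression). -/
noncomputable def jacobiP (a b β γ : ℝ) (n : ℕ) (x : ℝ) : ℝ :=
  jacobiDelta a b β γ n *
    ∑ k ∈ Finset.range (n + 1),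
      (-1 : ℝ) ^ (n - k) * (n.choose k : ℝ) *
        (∏ j ∈ Finset.range k, (β + n - j)) *
        (∏ j ∈ Finset.range (n - k), (γ + n - j)) *
        (x - a) ^ (n - k) * (b - x) ^ k

/-- The weight `ω^{β,γ}(x) = (x-a)^β (b-x)^γ`. -/
noncomputable def wgt (a b β γ : ℝ) (x : ℝ) : ℝ := (x - a) ^ β * (b - x) ^ γ

/-- Membership in the weighted Lebesgue space `L_p(I,β,γ)`, `I = (a,b)`. -/
def MemWLp (a b β γ p : ℝ) (f : ℝ → ℝ) : Prop :=
  AEStronglyMeasurable f (volume.restrict (Ioo a b)) ∧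
    ∫⁻ x in Ioo a b, ENNReal.ofReal (|f x| ^ p * wgt a b β γ x) < ⊤

/-- The norm of the weighted Lebesgue space `L_p(I,β,γ)`. -/
noncomputable def wLpNorm (a b β γ p : ℝ) (f : ℝ → ℝ) : ℝ :=
  (∫ x in Ioo a b, |f x| ^ p * wgt a b β γ x) ^ (1 / p)

/-- The left-sided Sonin-type integral operator `(I^ϱ_{a+} f)(x) = ∫_a^x ϱ(x-t) f(t) dt`. -/
noncomputable def soninI (a : ℝ) (ϱ f : ℝ → ℝ) (x : ℝ) : ℝ :=
  ∫ t in a..x, ϱ (x - t) * f t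

/-- The Sonin condition `(ϱ ∗ ϑ)(x) = 1` for a.e. `x ∈ (0, b-a)`. -/
def SoninCond (a b : ℝ) (ϱ ϑ : ℝ → ℝ) : Prop :=
  ∀ᵐ x ∂(volume.restrict (Ioo 0 (b - a))), ∫ t in (0 : ℝ)..x, ϱ (x - t) * ϑ t = 1

/-- The Jacobi coefficient `f^ϑ_n = ∫_a^b (I^ϑ_{a+}f)(x) p_n^{β-1,γ-1}(x) ω^{β-1,γ-1}(x) dx`. -/
noncomputable def soninCoef (a b β γ : ℝ) (ϑ f : ℝ → ℝ) (n : ℕ) : ℝ :=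
  ∫ x in Ioo a b, soninI a ϑ f x * jacobiP a b (β - 1) (γ - 1) n x * wgt a b (β - 1) (γ - 1) x

/-- A function in the weighted space `L_p(I,β,γ)` is integrable on `I` when `2 ≤ p` and
`0 < β, γ < 1`. -/
theorem MemWLp.integrableOn {a b β γ p : ℝ} {f : ℝ → ℝ} (hab : a < b)
    (hβ0 : 0 < β) (hβ1 : β < 1) (hγ0 : 0 < γ) (hγ1 : γ < 1) (hp : 2 ≤ p)
    (hf : MemWLp a b β γ p f) : IntegrableOn f (Ioo a b) := by
  obtain ⟨hm, hfin⟩ := hf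
  have hwm : AEStronglyMeasurable (fun x => |f x| ^ p * wgt a b β γ x)
      (volume.restrict (Ioo a b)) := by
    refine AEMeasurable.aestronglyMeasurable (AEMeasurable.mul ?_ ?_)
    · exact (measurable_norm.comp_aemeasurable hm.aemeasurable).pow_const p
    · unfold wgt
      fun_prop
  have hw : IntegrableOn (fun x => |f x| ^ p * wgt a b β γ x) (Ioo a b) := by
    refine ⟨hwm, ?_⟩
    rw [hasFiniteIntegral_iff_ofReal]
    · exact hfin
    · filter_upwards [ae_restrict_mem measurableSet_Ioo] with x hx
      have h1 : 0 < x - a := sub_pos.2 hx.1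
      have h2 : 0 < b - x := sub_pos.2 hx.2
      simp only [wgt, Pi.zero_apply]
      positivity
  have hleft : IntegrableOn (fun x => (x - a) ^ (-β)) (Ioo a b) := by
    have h := (intervalIntegral.intervalIntegrable_rpow' (a := 0) (b := b - a)
      (r := -β) (by linarith)).comp_sub_right a
    rw [zero_add, sub_add_cancel, intervalIntegrable_iff_integrableOn_Ioo_of_le hab.le] at h
    exact h
  have hright : IntegrableOn (fun x => (b - x) ^ (-γ)) (Ioo a b) := by
    have h := (intervalIntegral.intervalIntegrable_rpow' (a := 0) (b := b - a)
      (r := -γ) (by linarith)).comp_sub_left b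
    rw [sub_zero, sub_sub_cancel] at h
    exact (intervalIntegrable_iff_integrableOn_Ioo_of_le hab.le).1 h.symm
  have hone : IntegrableOn (fun _ => (1 : ℝ)) (Ioo a b) := by simp [IntegrableOn]
  set m := (b - a) / 2 with hmdef
  have hm0 : 0 < m := by rw [hmdef]; linarith
  refine Integrable.mono' (hone.add (hw.add
    ((hleft.const_mul (m ^ (-γ))).add (hright.const_mul (m ^ (-β)))))) hm ?_
  filter_upwards [ae_restrict_mem measurableSet_Ioo] with x hx
  have h1 : 0 < x - a := sub_pos.2 hx.1
  have h2 : 0 < b - x := sub_pos.2 hx.2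
  simp only [Pi.add_apply, Real.norm_eq_abs]
  have hwpos : 0 < wgt a b β γ x := by unfold wgt; positivity
  have hinv : (wgt a b β γ x)⁻¹ ≤
      m ^ (-γ) * (x - a) ^ (-β) + m ^ (-β) * (b - x) ^ (-γ) := by
    have he : (wgt a b β γ x)⁻¹ = (x - a) ^ (-β) * (b - x) ^ (-γ) := by
      rw [wgt, mul_inv, Real.rpow_neg h1.le, Real.rpow_neg h2.le]
    rw [he]
    rcases le_total m (b - x) with h | h
    · have := Real.rpow_le_rpow_of_nonpos hm0 h (neg_nonpos.2 hγ0.le)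
      have h3 : 0 ≤ m ^ (-β) * (b - x) ^ (-γ) := by positivity
      have h4 : 0 ≤ (x - a) ^ (-β) := by positivity
      nlinarith
    · have := Real.rpow_le_rpow_of_nonpos hm0 (z := -β) (y := x - a)
        (by rw [hmdef] at h ⊢; linarith) (neg_nonpos.2 hβ0.le)
      have h3 : 0 ≤ m ^ (-γ) * (x - a) ^ (-β) := by positivity
      have h4 : 0 ≤ (b - x) ^ (-γ) := by positivity
      nlinarith
  have hpow0 : 0 ≤ |f x| ^ p * wgt a b β γ x := by positivity
  have hinv0 : 0 < (wgt a b β γ x)⁻¹ := inv_pos.2 hwpos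
  rcases le_total |f x| 1 with h | h
  · linarith
  rcases le_total (|f x| * wgt a b β γ x) 1 with h' | h'
  · have : |f x| ≤ (wgt a b β γ x)⁻¹ := by
      rwa [← one_div, le_div_iff₀ hwpos]
    linarith
  · have hsq : |f x| ^ 2 ≤ |f x| ^ p := by
      rw [← Real.rpow_two]
      exact Real.rpow_le_rpow_of_exponent_le h hp
    have : |f x| ≤ |f x| ^ p * wgt a b β γ x := calc
      |f x| ≤ |f x| * (|f x| * wgt a b β γ x) := le_mul_of_one_le_right (abs_nonneg _) h'
      _ = |f x| ^ 2 * wgt a b β γ x := by ring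
      _ ≤ _ := mul_le_mul_of_nonneg_right hsq hwpos.le
    linarith

/-- The integrand of the convolution of truncated functions on `ℝ`. -/
theorem indicator_mul_indicator_sub {a b x : ℝ} (f g : ℝ → ℝ) (hx : x ∈ Ioo a b) (t : ℝ) :
    (Ioo a b).indicator f t * (Ioo 0 (b - a)).indicator g (x - t) =
      (Ioo a x).indicator (fun t => g (x - t) * f t) t := by
  by_cases ht : t ∈ Ioo a x
  · rw [indicator_of_mem ht, indicator_of_mem, indicator_of_mem, mul_comm]
    · exact ⟨by linarith [ht.2], by linarith [ht.1, hx.2]⟩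
    · exact ⟨ht.1, ht.2.trans hx.2⟩
  · rw [indicator_of_notMem ht]
    by_cases h : t ∈ Ioo a b
    · rw [indicator_of_notMem (a := x - t), mul_zero]
      exact fun h' => ht ⟨h.1, by linarith [h'.1]⟩
    · rw [indicator_of_notMem h, zero_mul]

/-- On `(a,b)`, the Sonin operator is a convolution of truncated functions on `ℝ`. -/
theorem convolution_indicator_eq_soninI {a b x : ℝ} (f g : ℝ → ℝ) (hx : x ∈ Ioo a b) :
    convolution ((Ioo a b).indicator f) ((Ioo 0 (b - a)).indicator g)
      (ContinuousLinearMap.mul ℝ ℝ) volume x = soninI a g f x := by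
  simp only [convolution_def, ContinuousLinearMap.mul_apply', indicator_mul_indicator_sub f g hx]
  rw [integral_indicator measurableSet_Ioo, soninI, intervalIntegral.integral_of_le hx.1.le,
    integral_Ioc_eq_integral_Ioo]

/-- The convolution of functions supported in `(a,b)` and `(0,c)` vanishes left of `a`. -/
theorem convolution_indicator_eq_zero {a b c x : ℝ} (f g : ℝ → ℝ) (hx : x ≤ a) :
    convolution ((Ioo a b).indicator f) ((Ioo 0 c).indicator g)
      (ContinuousLinearMap.mul ℝ ℝ) volume x = 0 := by
  rw [convolution_def]
  refine integral_eq_zero_of_ae (Eventually.of_forall fun t => ?_)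
  simp only [ContinuousLinearMap.mul_apply', Pi.zero_apply]
  by_cases h : t ∈ Ioo a b
  · rw [indicator_of_notMem (a := x - t), mul_zero]
    exact fun h' => by linarith [h.1, h'.1]
  · rw [indicator_of_notMem h, zero_mul]

/-- Convolution of integrable functions is associative almost everywhere. -/
theorem ae_convolution_assoc {f g k : ℝ → ℝ} (hf : Integrable f) (hg : Integrable g)
    (hk : Integrable k) :
    ∀ᵐ x : ℝ, convolution (convolution f g (ContinuousLinearMap.mul ℝ ℝ) volume) k
        (ContinuousLinearMap.mul ℝ ℝ) volume x =
      convolution f (convolution g k (ContinuousLinearMap.mul ℝ ℝ) volume)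
        (ContinuousLinearMap.mul ℝ ℝ) volume x := by
  have hgk := hg.norm.integrable_convolution (ContinuousLinearMap.mul ℝ ℝ) hk.norm
  filter_upwards [hf.norm.ae_convolution_exists (ContinuousLinearMap.mul ℝ ℝ) hgk] with x hx
  refine convolution_assoc _ _ _ _ (fun x y z => ?_) hf.aestronglyMeasurable
    hg.aestronglyMeasurable hk.aestronglyMeasurable (hf.ae_convolution_exists _ hg)
    (hg.norm.ae_convolution_exists _ hk.norm) hx
  simp [mul_assoc]

/-- An integrable function on `ℝ` whose primitive from `a` vanishes at almost every point of
`(a,b)` is almost everywhere zero on `(a,b)`. -/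
theorem ae_eq_zero_of_ae_intervalIntegral_eq_zero {a b : ℝ} {f : ℝ → ℝ} (hf : Integrable f)
    (h : ∀ᵐ x ∂(volume.restrict (Ioo a b)), ∫ t in a..x, f t = 0) :
    ∀ᵐ x ∂(volume.restrict (Ioo a b)), f x = 0 := by
  have hcont : Continuous fun x => ∫ t in a..x, f t :=
    intervalIntegral.continuous_primitive (fun _ _ => hf.intervalIntegrable) a
  have hzero : EqOn (fun x => ∫ t in a..x, f t) (fun _ => 0) (Ioo a b) :=
    Measure.eqOn_open_of_ae_eq h isOpen_Ioo hcont.continuousOn continuousOn_const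
  filter_upwards [ae_restrict_of_ae (LocallyIntegrable.ae_hasDerivAt_integral
      hf.locallyIntegrable),
    ae_restrict_mem measurableSet_Ioo] with x hx hmem
  have hev : (fun x => ∫ t in a..x, f t) =ᶠ[nhds x] fun _ => 0 :=
    hzero.eventuallyEq_of_mem (isOpen_Ioo.mem_nhds hmem)
  exact (hx a).unique ((hasDerivAt_const x (0 : ℝ)).congr_of_eventuallyEq hev)

/-- Injectivity of the Sonin operator on integrable functions. -/
theorem ae_eq_zero_of_soninI_eq_zero {a b : ℝ} {ϱ ϑ f : ℝ → ℝ}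
    (hϱ : IntegrableOn ϱ (Ioo 0 (b - a))) (hϑ : IntegrableOn ϑ (Ioo 0 (b - a)))
    (hson : SoninCond a b ϱ ϑ) (hf : IntegrableOn f (Ioo a b))
    (h : ∀ᵐ x ∂(volume.restrict (Ioo a b)), soninI a ϱ f x = 0) :
    ∀ᵐ x ∂(volume.restrict (Ioo a b)), f x = 0 := by
  set F := (Ioo a b).indicator f with hF
  set R := (Ioo 0 (b - a)).indicator ϱ with hR
  set T := (Ioo 0 (b - a)).indicator ϑ with hT
  have hFi : Integrable F := hf.integrable_indicator measurableSet_Ioo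
  have hRi : Integrable R := hϱ.integrable_indicator measurableSet_Ioo
  have hTi : Integrable T := hϑ.integrable_indicator measurableSet_Ioo
  have hflip : (ContinuousLinearMap.mul ℝ ℝ).flip = ContinuousLinearMap.mul ℝ ℝ := by
    ext; simp
  have hRT : ∀ᵐ y, y < b - a →
      convolution R T (ContinuousLinearMap.mul ℝ ℝ) volume y =
        (Ioo 0 (b - a)).indicator 1 y := by
    filter_upwards [(ae_restrict_iff' measurableSet_Ioo).1 hson] with y hy hyb
    rw [← convolution_flip, hflip]
    by_cases hmem : y ∈ Ioo 0 (b - a)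
    · have := convolution_indicator_eq_soninI ϑ ϱ hmem
      rw [sub_zero] at this
      rw [hT, hR, this, indicator_of_mem hmem]
      exact hy hmem
    · rw [indicator_of_notMem hmem]
      exact convolution_indicator_eq_zero _ _ (not_lt.1 fun h0 => hmem ⟨h0, hyb⟩)
  have hFR : ∀ᵐ y, y < b →
      convolution F R (ContinuousLinearMap.mul ℝ ℝ) volume y = 0 := by
    filter_upwards [(ae_restrict_iff' measurableSet_Ioo).1 h] with y hy hyb
    by_cases hmem : y ∈ Ioo a b
    · rw [hF, hR, convolution_indicator_eq_soninI f ϱ hmem, hy hmem]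
    · exact convolution_indicator_eq_zero _ _ (not_lt.1 fun h0 => hmem ⟨h0, hyb⟩)
  have hprim : ∀ᵐ x ∂(volume.restrict (Ioo a b)), ∫ t in a..x, F t = 0 := by
    filter_upwards [ae_restrict_of_ae (ae_convolution_assoc hFi hRi hTi),
      ae_restrict_mem measurableSet_Ioo] with x hx hmem
    have hleft : convolution (convolution F R (ContinuousLinearMap.mul ℝ ℝ) volume) T
        (ContinuousLinearMap.mul ℝ ℝ) volume x = 0 := by
      rw [convolution_def]
      refine integral_eq_zero_of_ae ?_
      filter_upwards [hFR] with t ht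
      simp only [ContinuousLinearMap.mul_apply', Pi.zero_apply]
      rcases lt_or_ge t b with htb | htb
      · rw [ht htb, zero_mul]
      · rw [hT, indicator_of_notMem, mul_zero]
        exact fun h' => by linarith [h'.1, hmem.2]
    have hright : convolution F (convolution R T (ContinuousLinearMap.mul ℝ ℝ) volume)
        (ContinuousLinearMap.mul ℝ ℝ) volume x = ∫ t in a..x, F t := by
      calc _ = convolution F ((Ioo 0 (b - a)).indicator 1)
            (ContinuousLinearMap.mul ℝ ℝ) volume x := by
            rw [convolution_def, convolution_def]
            refine integral_congr_ae ?_
            filter_upwards [(quasiMeasurePreserving_sub_left volume x).ae hRT] with t ht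
            by_cases htm : t ∈ Ioo a b
            · rw [ht (by linarith [htm.1, hmem.2])]
            · rw [hF, indicator_of_notMem htm, map_zero]; rfl
        _ = soninI a 1 f x := convolution_indicator_eq_soninI f 1 hmem
        _ = ∫ t in a..x, F t := by
            refine intervalIntegral.integral_congr_ae (Eventually.of_forall fun t ht => ?_)
            rw [uIoc_of_le hmem.1.le] at ht
            have htm : t ∈ Ioo a b := ⟨ht.1, ht.2.trans_lt hmem.2⟩
            rw [hF, indicator_of_mem htm, Pi.one_apply, one_mul]
    rw [← hright, ← hx, hleft]
  filter_upwards [ae_eq_zero_of_ae_intervalIntegral_eq_zero hFi hprim,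
    ae_restrict_mem measurableSet_Ioo] with x hx hmem
  rwa [hF, indicator_of_mem hmem] at hx

/-- The Sonin operator of an integrable function has an integrable integrand at almost every
point. -/
theorem ae_intervalIntegrable_soninI {a b : ℝ} {ϱ f : ℝ → ℝ}
    (hϱ : IntegrableOn ϱ (Ioo 0 (b - a))) (hf : IntegrableOn f (Ioo a b)) :
    ∀ᵐ x ∂(volume.restrict (Ioo a b)),
      IntervalIntegrable (fun t => ϱ (x - t) * f t) volume a x := by
  have h := (hf.integrable_indicator measurableSet_Ioo).ae_convolution_exists
    (ContinuousLinearMap.mul ℝ ℝ) (hϱ.integrable_indicator measurableSet_Ioo)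
  filter_upwards [ae_restrict_of_ae h, ae_restrict_mem measurableSet_Ioo] with x hx hmem
  simp only [ConvolutionExistsAt, ContinuousLinearMap.mul_apply',
    indicator_mul_indicator_sub f ϱ hmem] at hx
  rw [intervalIntegrable_iff_integrableOn_Ioo_of_le hmem.1.le]
  exact (integrable_indicator_iff measurableSet_Ioo).1 hx

/-- uniqueness of solutions of the Abel–Sonin equation in `L_p(I,β,γ)`. -/
theorem abel_sonin_uniqueness
    (a b β γ p : ℝ) (ϱ ϑ ψ φ : ℝ → ℝ)
    (hab : a < b) (hβ0 : 0 < β) (hβ1 : β < 1) (hγ0 : 0 < γ) (hγ1 : γ < 1) (hp : 2 ≤ p)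
    (hϱ1 : IntegrableOn ϱ (Ioo 0 (b - a)))
    (hϑ1 : IntegrableOn ϑ (Ioo 0 (b - a)))
    (hson : SoninCond a b ϱ ϑ)
    (hψ : MemWLp a b β γ p ψ) (hφ : MemWLp a b β γ p φ)
    (heq : ∀ᵐ x ∂(volume.restrict (Ioo a b)), soninI a ϱ ψ x = soninI a ϱ φ x) :
    ∀ᵐ x ∂(volume.restrict (Ioo a b)), ψ x = φ x := by
  have hψ1 := hψ.integrableOn hab hβ0 hβ1 hγ0 hγ1 hp
  have hφ1 := hφ.integrableOn hab hβ0 hβ1 hγ0 hγ1 hp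
  have hdiff : ∀ᵐ x ∂(volume.restrict (Ioo a b)), soninI a ϱ (fun t => ψ t - φ t) x = 0 := by
    filter_upwards [heq, ae_intervalIntegrable_soninI hϱ1 hψ1,
      ae_intervalIntegrable_soninI hϱ1 hφ1] with x hx h1 h2
    simp only [soninI, mul_sub] at hx ⊢
    rw [intervalIntegral.integral_sub h1 h2, hx, sub_self]
  filter_upwards [ae_eq_zero_of_soninI_eq_zero hϱ1 hϑ1 hson (hψ1.sub hφ1) hdiff] with x hx
  exact sub_eq_zero.1 hx
end

section
/- Let a < b be real numbers, I' = (0, b-a), let β, γ > 0, let ϑ ∈ L¹(I'), and let m, n ∈ ℕ₀. Then ∫_a^b p_m^{β,γ}(x) [ p_n^{β,γ}(a) ϑ(x-a) + ∫_a^x ϑ(x-t) (p_n^{β,γ})'(t) dt ] ω^{β,γ}(x) dx = √((m+1)(β+γ+m)) · ∫_a^b p_{m+1}^{β-1,γ-1}(x) ( ∫_a^x ϑ(x-t) p_n^{β,γ}(t) dt ) ω^{β-1,γ-1}(x) dx, both integrals being absolutely convergent. (Here the expression in square brackets is the a.e. derivative of x ↦ ∫_a^x ϑ(x-t) p_n^{β,γ}(t)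 dt.) -/
open MeasureTheory Set Filter

/-- The `k`-th derivative of `y ↦ y ^ μ` on `(0, ∞)`. -/
noncomputable def rpowDeriv (μ : ℝ) (k : ℕ) (y : ℝ) : ℝ :=
  (∏ j ∈ Finset.range k, (μ - j)) * y ^ (μ - k)

lemma hasDerivAt_rpowDeriv (μ : ℝ) (k : ℕ) {y : ℝ} (hy : 0 < y) :
    HasDerivAt (rpowDeriv μ k) (rpowDeriv μ (k + 1) y) y := by
  have h := (Real.hasDerivAt_rpow_const (p := μ - k) (Or.inl hy.ne')).const_mul
    (∏ j ∈ Finset.range k, (μ - j))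
  refine h.congr_deriv ?_
  simp only [rpowDeriv, Finset.prod_range_succ]
  push_cast
  rw [show μ - ((k : ℝ) + 1) = μ - k - 1 by ring]
  ring

/-- One step of the Leibniz rule for families of successive derivatives. -/
lemma hasDerivAt_leibniz_sum {A B : ℕ → ℝ → ℝ} {x : ℝ}
    (hA : ∀ k, HasDerivAt (A k) (A (k + 1) x) x) (hB : ∀ k, HasDerivAt (B k) (B (k + 1) x) x)
    (n : ℕ) :
    HasDerivAt (fun y => ∑ k ∈ Finset.range (n + 1), (n.choose k : ℝ) * (A k y * B (n - k) y))
      (∑ k ∈ Finset.range (n + 2), ((n + 1).choose k : ℝ) * (A k x * B (n + 1 - k) x)) x := by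
  have h := HasDerivAt.fun_sum (u := Finset.HasAntidiagonal.antidiagonal n) (x := x)
    (A := fun ij y => (n.choose ij.1 : ℝ) * (A ij.1 y * B ij.2 y))
    (fun ij _ => ((hA ij.1).mul (hB ij.2)).const_mul (n.choose ij.1 : ℝ))
  have hL : (fun y => ∑ k ∈ Finset.range (n + 1), (n.choose k : ℝ) * (A k y * B (n - k) y)) =
      fun y => ∑ ij ∈ Finset.HasAntidiagonal.antidiagonal n, (n.choose ij.1 : ℝ) * (A ij.1 y * B ij.2 y) := by
    funext y
    exact (Finset.Nat.sum_antidiagonal_eq_sum_range_succ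
      (fun i j => (n.choose i : ℝ) * (A i y * B j y)) n).symm
  rw [hL]
  refine h.congr_deriv ?_
  have hR := Finset.Nat.sum_antidiagonal_eq_sum_range_succ
    (fun i j => ((n + 1).choose i : ℝ) * (A i x * B j x)) (n + 1)
  rw [← hR, Finset.sum_antidiagonal_choose_succ_mul (fun i j => A i x * B j x) n,
    ← Finset.sum_add_distrib]
  refine Finset.sum_congr rfl fun ij hij => ?_
  rw [← Nat.choose_symm_of_eq_add (Finset.HasAntidiagonal.mem_antidiagonal.mp hij).symm]
  ring

/-- The Rodrigues formula, with the iterated derivative expanded by the Leibniz rule. -/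
lemma jacobiP_mul_wgt_eq (a b β γ : ℝ) (n : ℕ) {x : ℝ} (hx : x ∈ Ioo a b) :
    jacobiP a b β γ n x * wgt a b β γ x = jacobiDelta a b β γ n *
      ∑ k ∈ Finset.range (n + 1), (n.choose k : ℝ) * (rpowDeriv (β + n) k (x - a) *
        ((-1) ^ (n - k) * rpowDeriv (γ + n) (n - k) (b - x))) := by
  have ha : 0 < x - a := sub_pos.mpr hx.1
  have hb : 0 < b - x := sub_pos.mpr hx.2
  rw [jacobiP, mul_assoc, Finset.sum_mul]
  congr 1
  refine Finset.sum_congr rfl fun k hk => ?_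
  have hkn : k ≤ n := Nat.lt_succ_iff.mp (Finset.mem_range.mp hk)
  have e1 : β + n - k = β + ((n - k : ℕ) : ℝ) := by push_cast [hkn]; ring
  have e2 : γ + n - ((n - k : ℕ) : ℝ) = γ + k := by push_cast [hkn]; ring
  simp only [rpowDeriv, wgt]
  rw [e1, e2, Real.rpow_add ha, Real.rpow_add hb, Real.rpow_natCast, Real.rpow_natCast]
  ring

lemma jacobiDelta_eq_neg_sqrt_mul {a b β γ : ℝ} (hab : a < b) (hβ : 0 < β) (hγ : 0 < γ) (m : ℕ) :
    jacobiDelta a b β γ m = -Real.sqrt (((m : ℝ) + 1) * (β + γ + m)) *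
      jacobiDelta a b (β - 1) (γ - 1) (m + 1) := by
  have hba : 0 < b - a := sub_pos.mpr hab
  have hpos : 0 < β + γ + m := by positivity
  have h1 : (0 : ℝ) ≤ ((m : ℝ) + 1) * (β + γ + m) := by positivity
  have hG1 : Real.Gamma (β + m + 1) ≠ 0 := (Real.Gamma_pos_of_pos (by positivity)).ne'
  have hG2 : Real.Gamma (γ + m + 1) ≠ 0 := (Real.Gamma_pos_of_pos (by positivity)).ne'
  simp only [jacobiDelta]
  rw [neg_mul, mul_left_comm, ← Real.sqrt_mul h1, ← neg_mul]
  have e1 : ((m + 1 : ℕ) : ℝ) + (β - 1 + (γ - 1) + 1) / 2 = m + (β + γ + 1) / 2 := by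
    push_cast; ring
  rw [e1, pow_succ]
  congr 1
  · ring
  · congr 1
    have e2 : β - 1 + (γ - 1) + ((m + 1 : ℕ) : ℝ) + 1 = β + γ + m := by push_cast; ring
    have e3 : β - 1 + ((m + 1 : ℕ) : ℝ) + 1 = β + m + 1 := by push_cast; ring
    have e4 : γ - 1 + ((m + 1 : ℕ) : ℝ) + 1 = γ + m + 1 := by push_cast; ring
    have e5 : β - 1 + (γ - 1) + 2 * ((m + 1 : ℕ) : ℝ) + 1 = β + γ + 2 * m + 1 := by
      push_cast; ring
    rw [e2, e3, e4, e5, Real.Gamma_add_one hpos.ne', Nat.factorial_succ]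
    have hf : (m.factorial : ℝ) ≠ 0 := by positivity
    push_cast
    field_simp

lemma hasDerivAt_jacobiP_mul_wgt {a b β γ : ℝ} (hab : a < b) (hβ : 0 < β) (hγ : 0 < γ) (m : ℕ)
    {x : ℝ} (hx : x ∈ Ioo a b) :
    HasDerivAt (fun y => jacobiP a b β γ m y * wgt a b β γ y)
      (-Real.sqrt (((m : ℝ) + 1) * (β + γ + m)) *
        (jacobiP a b (β - 1) (γ - 1) (m + 1) x * wgt a b (β - 1) (γ - 1) x)) x := by
  have hA : ∀ k, HasDerivAt (fun y => rpowDeriv (β + m) k (y - a))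
      (rpowDeriv (β + m) (k + 1) (x - a)) x := fun k =>
    (hasDerivAt_rpowDeriv (β + m) k (sub_pos.mpr hx.1)).comp_sub_const x a
  have hB : ∀ k, HasDerivAt (fun y => (-1) ^ k * rpowDeriv (γ + m) k (b - y))
      ((-1) ^ (k + 1) * rpowDeriv (γ + m) (k + 1) (b - x)) x := fun k => by
    refine (((hasDerivAt_rpowDeriv (γ + m) k (sub_pos.mpr hx.2)).comp x
      ((hasDerivAt_id x).const_sub b)).const_mul ((-1) ^ k)).congr_deriv ?_
    ring
  have h := (hasDerivAt_leibniz_sum (A := fun k y => rpowDeriv (β + m) k (y - a))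
    (B := fun k y => (-1) ^ k * rpowDeriv (γ + m) k (b - y)) hA hB m).const_mul
    (jacobiDelta a b β γ m)
  refine (h.congr_of_eventuallyEq ?_).congr_deriv ?_
  · filter_upwards [Ioo_mem_nhds hx.1 hx.2] with y hy
    exact jacobiP_mul_wgt_eq a b β γ m hy
  · rw [jacobiP_mul_wgt_eq a b (β - 1) (γ - 1) (m + 1) hx, jacobiDelta_eq_neg_sqrt_mul hab hβ hγ,
      show β - 1 + ((m + 1 : ℕ) : ℝ) = β + m by push_cast; ring,
      show γ - 1 + ((m + 1 : ℕ) : ℝ) = γ + m by push_cast; ring, mul_assoc]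

lemma contDiff_jacobiP (a b β γ : ℝ) (n : ℕ) : ContDiff ℝ 1 (jacobiP a b β γ n) := by
  unfold jacobiP
  fun_prop

lemma continuous_wgt {a b β γ : ℝ} (hβ : 0 < β) (hγ : 0 < γ) : Continuous (wgt a b β γ) := by
  unfold wgt
  exact ((continuous_id.sub continuous_const).rpow_const fun _ => Or.inr hβ.le).mul
    ((continuous_const.sub continuous_id).rpow_const fun _ => Or.inr hγ.le)

lemma integrableOn_wgt {a b β γ : ℝ} (hab : a < b) (hβ : -1 < β) (hγ : -1 < γ) :
    IntegrableOn (wgt a b β γ) (Ioo a b) := by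
  obtain ⟨c, hac, hcb⟩ := exists_between hab
  have hl : IntervalIntegrable (wgt a b β γ) volume a c := by
    have h := (intervalIntegral.intervalIntegrable_rpow' (a := 0) (b := c - a) hβ).comp_sub_right a
    simp only [zero_add, sub_add_cancel] at h
    refine h.mul_continuousOn ?_
    refine ContinuousOn.rpow_const (by fun_prop) fun x hx => Or.inl ?_
    rw [uIcc_of_le hac.le] at hx
    linarith [hx.2]
  have hr : IntervalIntegrable (wgt a b β γ) volume c b := by
    have h := (intervalIntegral.intervalIntegrable_rpow' (a := b - c) (b := 0) hγ).comp_sub_left b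
    simp only [sub_sub_cancel, sub_zero] at h
    refine h.continuousOn_mul ?_
    refine ContinuousOn.rpow_const (by fun_prop) fun x hx => Or.inl ?_
    rw [uIcc_of_le hcb.le] at hx
    linarith [hx.1]
  exact (intervalIntegrable_iff_integrableOn_Ioo_of_le hab.le).mp (hl.trans hr)

lemma intervalIntegral_comp_sub_mul_eq {a b : ℝ} (ϑ Q : ℝ → ℝ) {x : ℝ} (hx : x ∈ Ioo a b) :
    ∫ t in a..x, ϑ (x - t) * Q t =
      ∫ s in Ioo 0 (b - a), ϑ s * (Ico a b).indicator Q (x - s) := by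
  have hsub := intervalIntegral.integral_comp_sub_left (a := a) (b := x)
    (fun s => ϑ s * Q (x - s)) x
  simp only [sub_sub_cancel, sub_self] at hsub
  have hcongr : EqOn (fun s => ϑ s * (Ico a b).indicator Q (x - s))
      ((Iic (x - a)).indicator fun s => ϑ s * Q (x - s)) (Ioo 0 (b - a)) := fun s hs => by
    by_cases h : s ≤ x - a
    · have hmem : x - s ∈ Ico a b := ⟨by linarith, by linarith [hs.1, hx.2]⟩
      simp [h, hmem]
    · have hmem : x - s ∉ Ico a b := fun h' => h (by linarith [h'.1])
      simp [h, hmem]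
  rw [hsub, intervalIntegral.integral_of_le (sub_nonneg.mpr hx.1.le),
    setIntegral_congr_fun measurableSet_Ioo hcongr, setIntegral_indicator measurableSet_Iic]
  congr 2
  ext s
  simp only [mem_Ioc, mem_inter_iff, mem_Ioo, mem_Iic]
  constructor
  · rintro ⟨h1, h2⟩
    exact ⟨⟨h1, by linarith [hx.2]⟩, h2⟩
  · rintro ⟨⟨h1, _⟩, h2⟩
    exact ⟨h1, h2⟩

lemma setIntegral_mul_indicator_comp_sub_eq {a b : ℝ} (w Q : ℝ → ℝ) {s : ℝ}
    (hs : s ∈ Ioo 0 (b - a)) :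
    ∫ x in Ioo a b, w x * (Ico a b).indicator Q (x - s) =
      ∫ x in (a + s)..b, w x * Q (x - s) := by
  have hcongr : EqOn (fun x => w x * (Ico a b).indicator Q (x - s))
      ((Ici (a + s)).indicator fun x => w x * Q (x - s)) (Ioo a b) := fun x hx => by
    by_cases h : a + s ≤ x
    · have hmem : x - s ∈ Ico a b := ⟨by linarith, by linarith [hs.1, hx.2]⟩
      simp [h, hmem]
    · have hmem : x - s ∉ Ico a b := fun h' => h (by linarith [h'.1])
      simp [h, hmem]
  rw [intervalIntegral.integral_of_le (by linarith [hs.2]), ← integral_Ico_eq_integral_Ioc,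
    setIntegral_congr_fun measurableSet_Ioo hcongr,
    setIntegral_indicator measurableSet_Ici]
  congr 2
  ext x
  simp only [mem_Ico, mem_inter_iff, mem_Ioo, mem_Ici]
  constructor
  · rintro ⟨⟨_, h1⟩, h2⟩
    exact ⟨h2, h1⟩
  · rintro ⟨h1, h2⟩
    exact ⟨⟨by linarith [hs.1], h2⟩, h1⟩

/-- Fubini's theorem for a truncated convolution tested against an integrable function. -/
lemma integral_mul_soninI_swap {a b : ℝ} {w ϑ Q : ℝ → ℝ}
    (hw : IntegrableOn w (Ioo a b)) (hϑ : IntegrableOn ϑ (Ioo 0 (b - a))) (hQ : Continuous Q) :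
    IntegrableOn (fun x => w x * ∫ t in a..x, ϑ (x - t) * Q t) (Ioo a b) ∧
    IntegrableOn (fun s => ϑ s * ∫ x in (a + s)..b, w x * Q (x - s)) (Ioo 0 (b - a)) ∧
    ∫ x in Ioo a b, w x * ∫ t in a..x, ϑ (x - t) * Q t =
      ∫ s in Ioo 0 (b - a), ϑ s * ∫ x in (a + s)..b, w x * Q (x - s) := by
  obtain ⟨C, hC⟩ := isCompact_Icc.exists_bound_of_continuousOn (s := Icc a b) hQ.continuousOn
  have hbound : ∀ y, ‖(Ico a b).indicator Q y‖ ≤ |C| := fun y => by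
    by_cases hy : y ∈ Ico a b
    · rw [indicator_of_mem hy]
      exact (hC y (Ico_subset_Icc_self hy)).trans (le_abs_self C)
    · simp [hy]
  have hmeas : Measurable fun z : ℝ × ℝ => (Ico a b).indicator Q (z.1 - z.2) :=
    (hQ.measurable.indicator measurableSet_Ico).comp (measurable_fst.sub measurable_snd)
  have hK : Integrable
      (fun z : ℝ × ℝ => w z.1 * ϑ z.2 * (Ico a b).indicator Q (z.1 - z.2))
      ((volume.restrict (Ioo a b)).prod (volume.restrict (Ioo 0 (b - a)))) :=
    (Integrable.mul_prod hw hϑ).mul_bdd hmeas.aestronglyMeasurable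
      (Eventually.of_forall fun z => hbound (z.1 - z.2))
  have hleft : EqOn (fun x => ∫ s in Ioo 0 (b - a), w x * ϑ s * (Ico a b).indicator Q (x - s))
      (fun x => w x * ∫ t in a..x, ϑ (x - t) * Q t) (Ioo a b) := fun x hx => by
    simp only [intervalIntegral_comp_sub_mul_eq ϑ Q hx, mul_assoc, integral_const_mul]
  have hright : EqOn (fun s => ∫ x in Ioo a b, w x * ϑ s * (Ico a b).indicator Q (x - s))
      (fun s => ϑ s * ∫ x in (a + s)..b, w x * Q (x - s)) (Ioo 0 (b - a)) := fun s hs => by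
    simp only [← setIntegral_mul_indicator_comp_sub_eq w Q hs, ← integral_const_mul]
    refine integral_congr_ae (Eventually.of_forall fun x => ?_)
    simp only
    ring
  refine ⟨?_, ?_, ?_⟩
  · exact IntegrableOn.congr_fun hK.integral_prod_left hleft measurableSet_Ioo
  · exact IntegrableOn.congr_fun hK.integral_prod_right hright measurableSet_Ioo
  · rw [← setIntegral_congr_fun measurableSet_Ioo hleft,
      ← setIntegral_congr_fun measurableSet_Ioo hright]
    exact integral_integral_swap hK

/-- Lemma 1: integration-by-parts identity relating
`∫ p_m (D^ϑ p_n) ω^{β,γ}` and `∫ p_{m+1}^{β-1,γ-1} (I^ϑ p_n) ω^{β-1,γ-1}`. -/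
theorem jacobi_sonin_integration_by_parts
    (a b β γ : ℝ) (ϑ : ℝ → ℝ) (m n : ℕ)
    (hab : a < b) (hβ : 0 < β) (hγ : 0 < γ)
    (hϑ1 : IntegrableOn ϑ (Ioo 0 (b - a))) :
    IntegrableOn (fun x => jacobiP a b β γ m x *
        (jacobiP a b β γ n a * ϑ (x - a) +
          ∫ t in a..x, ϑ (x - t) * deriv (jacobiP a b β γ n) t) *
        wgt a b β γ x) (Ioo a b) ∧
    IntegrableOn (fun x => jacobiP a b (β - 1) (γ - 1) (m + 1) x *
        (∫ t in a..x, ϑ (x - t) * jacobiP a b β γ n t) *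
        wgt a b (β - 1) (γ - 1) x) (Ioo a b) ∧
    ∫ x in Ioo a b, jacobiP a b β γ m x *
        (jacobiP a b β γ n a * ϑ (x - a) +
          ∫ t in a..x, ϑ (x - t) * deriv (jacobiP a b β γ n) t) *
        wgt a b β γ x =
      Real.sqrt (((m : ℝ) + 1) * (β + γ + m)) *
        ∫ x in Ioo a b, jacobiP a b (β - 1) (γ - 1) (m + 1) x *
          (∫ t in a..x, ϑ (x - t) * jacobiP a b β γ n t) *
          wgt a b (β - 1) (γ - 1) x := by
  set P := jacobiP a b β γ n with hP
  set W : ℝ → ℝ := fun x => jacobiP a b β γ m x * wgt a b β γ x with hW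
  set w : ℝ → ℝ := fun x => jacobiP a b (β - 1) (γ - 1) (m + 1) x * wgt a b (β - 1) (γ - 1) x
    with hw
  set c := Real.sqrt (((m : ℝ) + 1) * (β + γ + m)) with hc
  have hPdiff : ContDiff ℝ 1 P := contDiff_jacobiP a b β γ n
  have hP'cont : Continuous (deriv P) := hPdiff.continuous_deriv le_rfl
  have hWcont : Continuous W := (contDiff_jacobiP a b β γ m).continuous.mul (continuous_wgt hβ hγ)
  have hWb : W b = 0 := by simp [hW, wgt, Real.zero_rpow hγ.ne']
  have hWint : IntegrableOn W (Ioo a b) :=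
    (hWcont.integrableOn_Icc).mono_set Ioo_subset_Icc_self
  have hwint : IntegrableOn w (Ioo a b) := by
    obtain ⟨C, hC⟩ := isCompact_Icc.exists_bound_of_continuousOn (s := Icc a b)
      (contDiff_jacobiP a b (β - 1) (γ - 1) (m + 1)).continuous.continuousOn
    refine Integrable.bdd_mul (c := C) (integrableOn_wgt hab (by linarith) (by linarith))
      (contDiff_jacobiP a b (β - 1) (γ - 1) (m + 1)).continuous.aestronglyMeasurable ?_
    exact (ae_restrict_iff' measurableSet_Ioo).mpr
      (Eventually.of_forall fun x hx => hC x (Ioo_subset_Icc_self hx))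
  obtain ⟨hI1, hJ1, hE1⟩ := integral_mul_soninI_swap hWint hϑ1 hP'cont
  obtain ⟨hI2, hJ2, hE2⟩ := integral_mul_soninI_swap hwint hϑ1 hPdiff.continuous
  have hshift : IntegrableOn (fun x => ϑ (x - a)) (Ioo a b) := by
    have h := ((intervalIntegrable_iff_integrableOn_Ioo_of_le (sub_nonneg.mpr hab.le)).mpr
      hϑ1).comp_sub_right a
    rw [zero_add, sub_add_cancel] at h
    exact (intervalIntegrable_iff_integrableOn_Ioo_of_le hab.le).mp h
  have hI0 : IntegrableOn (fun x => P a * (W x * ϑ (x - a))) (Ioo a b) := by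
    obtain ⟨C, hC⟩ := isCompact_Icc.exists_bound_of_continuousOn (s := Icc a b)
      hWcont.continuousOn
    refine (Integrable.bdd_mul (c := C) hshift hWcont.aestronglyMeasurable ?_).const_mul (P a)
    exact (ae_restrict_iff' measurableSet_Ioo).mpr
      (Eventually.of_forall fun x hx => hC x (Ioo_subset_Icc_self hx))
  have hE0 : ∫ x in Ioo a b, P a * (W x * ϑ (x - a)) =
      ∫ s in Ioo 0 (b - a), P a * (W (a + s) * ϑ s) := by
    have h := intervalIntegral.integral_comp_sub_right (a := a) (b := b)
      (fun s => P a * (W (a + s) * ϑ s)) a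
    simp only [add_sub_cancel, sub_self] at h
    rwa [intervalIntegral.integral_of_le hab.le,
      intervalIntegral.integral_of_le (sub_nonneg.mpr hab.le), integral_Ioc_eq_integral_Ioo,
      integral_Ioc_eq_integral_Ioo] at h
  have hparts : EqOn (fun s => ϑ s * ∫ x in (a + s)..b, W x * deriv P (x - s))
      (fun s => c * (ϑ s * ∫ x in (a + s)..b, w x * P (x - s)) - P a * (W (a + s) * ϑ s))
      (Ioo 0 (b - a)) := fun s hs => by
    have hsb : a + s ≤ b := by linarith [hs.2]
    have h := intervalIntegral.integral_mul_deriv_eq_deriv_mul_of_hasDerivAt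
      (a := a + s) (b := b) (u := W) (v := fun x => P (x - s)) (u' := fun x => -c * w x)
      (v' := fun x => deriv P (x - s)) hWcont.continuousOn
      (hPdiff.continuous.comp (continuous_id.sub continuous_const)).continuousOn
      (fun x hx => by
        rw [min_eq_left hsb, max_eq_right hsb] at hx
        exact hasDerivAt_jacobiP_mul_wgt hab hβ hγ m ⟨by linarith [hx.1, hs.1], hx.2⟩)
      (fun x _ => ((hPdiff.differentiable one_ne_zero (x - s)).hasDerivAt).comp_sub_const x s)
      (((intervalIntegrable_iff_integrableOn_Ioo_of_le hsb).mpr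
        (hwint.mono_set (Ioo_subset_Ioo_left (by linarith [hs.1])))).const_mul (-c))
      (Continuous.intervalIntegrable (by fun_prop) _ _)
    simp only [mul_assoc, intervalIntegral.integral_const_mul, hWb, add_sub_cancel_right] at h
    simp only [h]
    ring
  have hsplit : ∀ x, jacobiP a b β γ m x *
      (P a * ϑ (x - a) + ∫ t in a..x, ϑ (x - t) * deriv P t) * wgt a b β γ x =
      P a * (W x * ϑ (x - a)) + W x * ∫ t in a..x, ϑ (x - t) * deriv P t := fun x => by
    simp only [hW]
    ring
  have hcomm : ∀ x, jacobiP a b (β - 1) (γ - 1) (m + 1) x *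
      (∫ t in a..x, ϑ (x - t) * P t) * wgt a b (β - 1) (γ - 1) x =
      w x * ∫ t in a..x, ϑ (x - t) * P t := fun x => by
    simp only [hw]
    ring
  simp only [hsplit, hcomm]
  refine ⟨hI0.add hI1, hI2, ?_⟩
  have hJ0 : IntegrableOn (fun s => P a * (W (a + s) * ϑ s)) (Ioo 0 (b - a)) := by
    refine IntegrableOn.congr_fun ((hJ2.const_mul c).sub hJ1) (fun s hs => ?_) measurableSet_Ioo
    have := hparts hs
    simp only [Pi.sub_apply] at this ⊢
    linarith
  rw [integral_add hI0 hI1, hE0, hE1, hE2, setIntegral_congr_fun measurableSet_Ioo hparts,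
    integral_sub (hJ2.const_mul c) hJ0, integral_const_mul c]
  ring
end

section
/- Let a < b be real numbers, I = (a,b), I' = (0, b-a), let 0 < β < 1 with β ≤ γ, and suppose there exist δ₁, δ₂ > 0 with δ₁ + β ≤ 1 and δ₂ ≤ γ; set k = δ₁ + δ₂. Let ϑ be measurable on I' with ∫₀^{b-a} |ϑ(t)|² t^{-k} dt < ∞. Then there exists a constant C (independent of m and f) such that for every m ∈ ℕ₀ and every f ∈ L₂(I,β,γ): | ∫_a^b p_m^{β-1,γ-1}(x) ( ∫_a^x ϑ(x-t) f(t) dt ) ω^{β-1,γ-1}(x) dx | ≤ C ‖f‖_{L₂(I,β,γ)}. -/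
open MeasureTheory Set Filter

/-- The beta integral over `(c, d)`, as a lower Lebesgue integral. -/
theorem lintegral_rpow_mul_rpow_Ioo {c d p q : ℝ} (hcd : c < d) (hp : 0 < p) (hq : 0 < q) :
    ∫⁻ x in Ioo c d, ENNReal.ofReal ((x - c) ^ (p - 1) * (d - x) ^ (q - 1)) =
      ENNReal.ofReal ((d - c) ^ (p + q - 1) * ProbabilityTheory.beta p q) := by
  have hL : 0 < d - c := sub_pos.2 hcd
  have hb := ProbabilityTheory.beta_pos hp hq
  have hunit : ∫⁻ x in Ioo (0 : ℝ) 1, ENNReal.ofReal (x ^ (p - 1) * (1 - x) ^ (q - 1)) =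
      ENNReal.ofReal (ProbabilityTheory.beta p q) := by
    have h1 := ProbabilityTheory.lintegral_betaPDF_eq_one hp hq
    rw [ProbabilityTheory.lintegral_betaPDF] at h1
    simp_rw [mul_assoc, ENNReal.ofReal_mul (one_div_pos.2 hb).le] at h1
    rw [lintegral_const_mul' _ _ ENNReal.ofReal_ne_top] at h1
    have h2 : ENNReal.ofReal (ProbabilityTheory.beta p q) *
        ENNReal.ofReal (1 / ProbabilityTheory.beta p q) = 1 := by
      rw [← ENNReal.ofReal_mul hb.le, mul_one_div_cancel hb.ne', ENNReal.ofReal_one]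
    rw [← one_mul (lintegral _ _), ← h2, mul_assoc, h1, mul_one]
  have himg : (fun x : ℝ => (d - c) * x + c) '' Ioo 0 1 = Ioo c d := by
    rw [image_affine_Ioo hL]
    congr 1 <;> ring
  rw [← himg, lintegral_image_eq_lintegral_abs_deriv_mul measurableSet_Ioo
    (f' := fun _ => d - c) (fun x _ => by
      simpa using (((hasDerivAt_id x).const_mul (d - c)).add_const c).hasDerivWithinAt)
    (fun x _ y _ h => by simpa [hL.ne'] using h), mul_comm, ENNReal.ofReal_mul hb.le, ← hunit,
    ← lintegral_mul_const' _ _ ENNReal.ofReal_ne_top]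
  refine setLIntegral_congr_fun measurableSet_Ioo fun x hx => ?_
  have hx0 : 0 ≤ x := hx.1.le
  have hx1 : 0 ≤ 1 - x := sub_nonneg.2 hx.2.le
  rw [abs_of_pos hL, ← ENNReal.ofReal_mul hL.le, ← ENNReal.ofReal_mul (by positivity)]
  congr 1
  rw [add_sub_cancel_right, show d - ((d - c) * x + c) = (d - c) * (1 - x) by ring,
    Real.mul_rpow hL.le hx0, Real.mul_rpow hL.le hx1,
    show p + q - 1 = (p - 1) + (q - 1) + 1 by ring, Real.rpow_add hL, Real.rpow_add hL,
    Real.rpow_one]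
  ring

theorem measurable_rpow_mul_rpow (c d p q : ℝ) :
    Measurable fun x : ℝ => (x - c) ^ p * (d - x) ^ q := by
  fun_prop

theorem rpow_mul_rpow_nonneg_ae (c d p q : ℝ) :
    0 ≤ᵐ[volume.restrict (Ioo c d)] fun x : ℝ => (x - c) ^ p * (d - x) ^ q :=
  ae_restrict_of_forall_mem measurableSet_Ioo fun _ hx =>
    mul_nonneg (Real.rpow_nonneg (sub_nonneg.2 hx.1.le) _)
      (Real.rpow_nonneg (sub_nonneg.2 hx.2.le) _)

theorem integrableOn_rpow_mul_rpow_Ioo {c d p q : ℝ} (hcd : c < d) (hp : 0 < p) (hq : 0 < q) :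
    IntegrableOn (fun x : ℝ => (x - c) ^ (p - 1) * (d - x) ^ (q - 1)) (Ioo c d) := by
  refine ⟨(measurable_rpow_mul_rpow c d _ _).aestronglyMeasurable, ?_⟩
  rw [hasFiniteIntegral_iff_ofReal (rpow_mul_rpow_nonneg_ae c d _ _),
    lintegral_rpow_mul_rpow_Ioo hcd hp hq]
  exact ENNReal.ofReal_lt_top

theorem integral_rpow_mul_rpow_Ioo {c d p q : ℝ} (hcd : c < d) (hp : 0 < p) (hq : 0 < q) :
    ∫ x in Ioo c d, (x - c) ^ (p - 1) * (d - x) ^ (q - 1) =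
      (d - c) ^ (p + q - 1) * ProbabilityTheory.beta p q := by
  rw [integral_eq_lintegral_of_nonneg_ae (rpow_mul_rpow_nonneg_ae c d _ _)
    (measurable_rpow_mul_rpow c d _ _).aestronglyMeasurable, lintegral_rpow_mul_rpow_Ioo hcd hp hq]
  exact ENNReal.toReal_ofReal (mul_nonneg (Real.rpow_nonneg (sub_pos.2 hcd).le _)
    (ProbabilityTheory.beta_pos hp hq).le)

theorem pow_mul_pow_mul_wgt {a b B G x : ℝ} (hx : x ∈ Ioo a b) (i j : ℕ) :
    (x - a) ^ i * (b - x) ^ j * wgt a b B G x =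
      (x - a) ^ (B + i + 1 - 1) * (b - x) ^ (G + j + 1 - 1) := by
  rw [wgt, add_sub_cancel_right, add_sub_cancel_right, Real.rpow_add (sub_pos.2 hx.1),
    Real.rpow_add (sub_pos.2 hx.2), Real.rpow_natCast, Real.rpow_natCast]
  ring

theorem integrableOn_pow_mul_pow_mul_wgt {a b B G : ℝ} (hab : a < b) (hB : -1 < B) (hG : -1 < G)
    (i j : ℕ) : IntegrableOn (fun x => (x - a) ^ i * (b - x) ^ j * wgt a b B G x) (Ioo a b) :=
  (integrableOn_congr_fun (fun _ hx => pow_mul_pow_mul_wgt hx i j) measurableSet_Ioo).2 <|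
    integrableOn_rpow_mul_rpow_Ioo hab (by have := i.cast_nonneg (α := ℝ); linarith)
      (by have := j.cast_nonneg (α := ℝ); linarith)

theorem integral_pow_mul_pow_mul_wgt {a b B G : ℝ} (hab : a < b) (hB : -1 < B) (hG : -1 < G)
    (i j : ℕ) : ∫ x in Ioo a b, (x - a) ^ i * (b - x) ^ j * wgt a b B G x =
      (b - a) ^ (B + G + (i + j : ℕ) + 1) * ProbabilityTheory.beta (B + i + 1) (G + j + 1) := by
  rw [setIntegral_congr_fun measurableSet_Ioo (fun _ hx => pow_mul_pow_mul_wgt hx i j),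
    integral_rpow_mul_rpow_Ioo hab (by have := i.cast_nonneg (α := ℝ); linarith)
      (by have := j.cast_nonneg (α := ℝ); linarith)]
  congr 2
  push_cast
  ring

/-- The falling-factorial form of the functional equation of `Γ`. -/
theorem prod_sub_mul_Gamma (s : ℝ) (k : ℕ) (h : 0 < s - k + 1) :
    (∏ j ∈ Finset.range k, (s - j)) * Real.Gamma (s - k + 1) = Real.Gamma (s + 1) := by
  induction k with
  | zero => simp
  | succ k ih =>
    push_cast at h ⊢
    rw [Finset.prod_range_succ, ← ih (by linarith), mul_assoc,
      show s - (k + 1) + 1 = s - k by ring, ← Real.Gamma_add_one (by linarith)]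

/-- Chu-Vandermonde identity for falling factorials of real numbers. -/
theorem sum_choose_mul_prod_sub_mul_prod_sub (r s : ℝ) (n : ℕ) :
    ∑ k ∈ Finset.range (n + 1), (n.choose k : ℝ) * ((∏ j ∈ Finset.range k, (r - j)) *
      ∏ j ∈ Finset.range (n - k), (s - j)) = ∏ j ∈ Finset.range n, (r + s - j) := by
  have key (r : ℝ) (k : ℕ) :
      (descPochhammer ℤ k).smeval r = ∏ j ∈ Finset.range k, (r - j) := by
    induction k with
    | zero => simp
    | succ k ih =>
      rw [descPochhammer_succ_right, Polynomial.smeval_mul, ih, Finset.prod_range_succ]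
      simp [Polynomial.smeval_sub, Polynomial.smeval_natCast]
  have h := Ring.descPochhammer_smeval_add n (Commute.all r s)
  simp only [key] at h
  rw [h, Finset.Nat.sum_antidiagonal_eq_sum_range_succ_mk]

open Polynomial in
/-- The polynomial `∏_{j < i} (z + j - X)`. -/
noncomputable def risingFactorialSub (z : ℝ) (i : ℕ) : ℝ[X] :=
  ∏ j ∈ Finset.range i, (C (-1) * X + C (z + j))

theorem natDegree_risingFactorialSub (z : ℝ) (i : ℕ) : (risingFactorialSub z i).natDegree = i := by
  rw [risingFactorialSub, Polynomial.natDegree_prod _ _ fun j _ h => by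
    have := Polynomial.natDegree_linear (a := (-1 : ℝ)) (b := z + j) (by norm_num)
    rw [h] at this
    simp at this]
  simp only [Polynomial.natDegree_linear (neg_ne_zero.2 (one_ne_zero (α := ℝ)))]
  simp

theorem leadingCoeff_risingFactorialSub (z : ℝ) (i : ℕ) :
    (risingFactorialSub z i).leadingCoeff = (-1) ^ i := by
  rw [risingFactorialSub, Polynomial.leadingCoeff_prod]
  simp only [Polynomial.leadingCoeff_linear (neg_ne_zero.2 (one_ne_zero (α := ℝ)))]
  simp

theorem eval_risingFactorialSub_mul_Gamma (z : ℝ) (i : ℕ) (x : ℝ) (h : 0 < z - x) :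
    (risingFactorialSub z i).eval x * Real.Gamma (z - x) = Real.Gamma (z - x + i) := by
  induction i with
  | zero => simp [risingFactorialSub]
  | succ i ih =>
    rw [risingFactorialSub, Finset.prod_range_succ, ← risingFactorialSub, Polynomial.eval_mul,
      mul_right_comm, ih, Nat.cast_succ, ← add_assoc,
      Real.Gamma_add_one (by have := i.cast_nonneg (α := ℝ); linarith)]
    simp
    ring

theorem sum_neg_one_pow_mul_choose_mul_eval (P : Polynomial ℝ) (n : ℕ) :
    ∑ k ∈ Finset.range (n + 1), (-1 : ℝ) ^ (n - k) * (n.choose k : ℝ) * P.eval (k : ℝ) =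
      (fwdDiff (1 : ℝ))^[n] P.eval 0 := by
  rw [fwdDiff_iter_eq_sum_shift]
  simp

theorem sum_neg_one_pow_mul_choose_mul_eval_risingFactorialSub (z : ℝ) {i n : ℕ} (h : i ≤ n) :
    ∑ k ∈ Finset.range (n + 1), (-1 : ℝ) ^ (n - k) * (n.choose k : ℝ) *
      (risingFactorialSub z i).eval (k : ℝ) = if i = n then (-1) ^ n * (n.factorial : ℝ) else 0 := by
  rw [sum_neg_one_pow_mul_choose_mul_eval]
  split_ifs with hi
  · subst hi
    have := (risingFactorialSub z i).fwdDiff_iter_degree_eq_factorial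
    rw [natDegree_risingFactorialSub, leadingCoeff_risingFactorialSub] at this
    rw [this]
    simp
  · rw [Polynomial.fwdDiff_iter_eq_zero_of_degree_lt
      (by rw [natDegree_risingFactorialSub]; exact lt_of_le_of_ne h hi)]
    rfl

/-- The coefficients in the Leibniz expansion of the Rodrigues formula. -/
noncomputable def rodriguesCoeff (B G : ℝ) (n k : ℕ) : ℝ :=
  (-1 : ℝ) ^ (n - k) * (n.choose k : ℝ) * (∏ j ∈ Finset.range k, (B + n - j)) *
    ∏ j ∈ Finset.range (n - k), (G + n - j)

/-- The Jacobi polynomial without its normalizing constant. -/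
noncomputable def rodriguesSum (a b B G : ℝ) (n : ℕ) (x : ℝ) : ℝ :=
  ∑ k ∈ Finset.range (n + 1), rodriguesCoeff B G n k * (x - a) ^ (n - k) * (b - x) ^ k

theorem jacobiP_eq (a b B G : ℝ) (n : ℕ) (x : ℝ) :
    jacobiP a b B G n x = jacobiDelta a b B G n * rodriguesSum a b B G n x := rfl

theorem rodriguesSum_mul_pow_mul_wgt (a b B G : ℝ) (n i : ℕ) (x : ℝ) :
    rodriguesSum a b B G n x * (x - a) ^ i * wgt a b B G x =
      ∑ k ∈ Finset.range (n + 1),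
        rodriguesCoeff B G n k * ((x - a) ^ (n - k + i) * (b - x) ^ k * wgt a b B G x) := by
  rw [rodriguesSum, Finset.sum_mul, Finset.sum_mul]
  refine Finset.sum_congr rfl fun k _ => ?_
  rw [pow_add]
  ring

theorem integrableOn_rodriguesSum_mul_pow {a b B G : ℝ} (hab : a < b) (hB : -1 < B) (hG : -1 < G)
    (n i : ℕ) :
    IntegrableOn (fun x => rodriguesSum a b B G n x * (x - a) ^ i * wgt a b B G x) (Ioo a b) := by
  simp only [rodriguesSum_mul_pow_mul_wgt]
  exact integrable_finsetSum _ fun k _ =>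
    (integrableOn_pow_mul_pow_mul_wgt hab hB hG _ _).const_mul _

theorem integral_rodriguesSum_mul_pow {a b B G : ℝ} (hab : a < b) (hB : -1 < B) (hG : -1 < G)
    {n i : ℕ} (hi : i ≤ n) :
    ∫ x in Ioo a b, rodriguesSum a b B G n x * (x - a) ^ i * wgt a b B G x =
      if i = n then (-1) ^ n * (n.factorial : ℝ) * ((b - a) ^ (B + G + (2 * n : ℕ) + 1) *
        (Real.Gamma (B + n + 1) * Real.Gamma (G + n + 1) / Real.Gamma (B + G + (2 * n : ℕ) + 2)))
      else 0 := by
  set M := (b - a) ^ (B + G + (n + i : ℕ) + 1) *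
    (Real.Gamma (B + n + 1) * Real.Gamma (G + n + 1) / Real.Gamma (B + G + (n + i : ℕ) + 2))
    with hM
  have term : ∀ k ∈ Finset.range (n + 1),
      ∫ x in Ioo a b, rodriguesCoeff B G n k *
        ((x - a) ^ (n - k + i) * (b - x) ^ k * wgt a b B G x) =
      M * ((-1 : ℝ) ^ (n - k) * (n.choose k : ℝ) *
        (risingFactorialSub (B + n + 1) i).eval (k : ℝ)) := by
    intro k hk
    have hkn : k ≤ n := Nat.lt_succ_iff.1 (Finset.mem_range.1 hk)
    have hkn' : (k : ℝ) ≤ n := by exact_mod_cast hkn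
    have hk0 : (0 : ℝ) ≤ k := k.cast_nonneg
    rw [integral_const_mul, integral_pow_mul_pow_mul_wgt hab hB hG, ProbabilityTheory.beta,
      rodriguesCoeff, hM, ← prod_sub_mul_Gamma (B + n) k (by linarith),
      ← prod_sub_mul_Gamma (G + n) (n - k) (by rw [Nat.cast_sub hkn]; linarith),
      show n - k + i + k = n + i by omega, Nat.cast_sub hkn,
      show B + (n - k + i : ℕ) + 1 = B + n + 1 - k + i by push_cast [hkn]; ring,
      ← eval_risingFactorialSub_mul_Gamma _ _ _ (by linarith),
      show B + n + 1 - k + i + (G + k + 1) = B + G + (n + i : ℕ) + 2 by push_cast; ring,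
      show B + n - k + 1 = B + n + 1 - k by ring, show G + n - (n - k : ℝ) + 1 = G + k + 1 by ring]
    ring
  simp only [rodriguesSum_mul_pow_mul_wgt]
  rw [integral_finsetSum _ fun k _ => (integrableOn_pow_mul_pow_mul_wgt hab hB hG _ _).const_mul _,
    Finset.sum_congr rfl term, ← Finset.mul_sum,
    sum_neg_one_pow_mul_choose_mul_eval_risingFactorialSub _ hi]
  split_ifs with h
  · subst h
    rw [hM, ← two_mul, mul_comm]
  · simp

theorem rodriguesSum_mul_eval_mul_wgt {n : ℕ} (a b B G : ℝ) {q : Polynomial ℝ}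
    (hq : q.natDegree ≤ n) (x : ℝ) :
    rodriguesSum a b B G n x * q.eval (x - a) * wgt a b B G x =
      ∑ i ∈ Finset.range (n + 1),
        q.coeff i * (rodriguesSum a b B G n x * (x - a) ^ i * wgt a b B G x) := by
  rw [Polynomial.eval_eq_sum_range' (Nat.lt_succ_of_le hq), Finset.mul_sum, Finset.sum_mul]
  exact Finset.sum_congr rfl fun i _ => by ring

theorem integrableOn_rodriguesSum_mul_eval {a b B G : ℝ} (hab : a < b) (hB : -1 < B)
    (hG : -1 < G) {n : ℕ} {q : Polynomial ℝ} (hq : q.natDegree ≤ n) :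
    IntegrableOn (fun x => rodriguesSum a b B G n x * q.eval (x - a) * wgt a b B G x)
      (Ioo a b) := by
  simp only [rodriguesSum_mul_eval_mul_wgt a b B G hq]
  exact integrable_finsetSum _ fun i _ =>
    (integrableOn_rodriguesSum_mul_pow hab hB hG n i).const_mul _

theorem integral_rodriguesSum_mul_eval {a b B G : ℝ} (hab : a < b) (hB : -1 < B) (hG : -1 < G)
    {n : ℕ} {q : Polynomial ℝ} (hq : q.natDegree ≤ n) :
    ∫ x in Ioo a b, rodriguesSum a b B G n x * q.eval (x - a) * wgt a b B G x =
      q.coeff n * ((-1) ^ n * (n.factorial : ℝ) * ((b - a) ^ (B + G + (2 * n : ℕ) + 1) *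
        (Real.Gamma (B + n + 1) * Real.Gamma (G + n + 1) /
          Real.Gamma (B + G + (2 * n : ℕ) + 2)))) := by
  simp only [rodriguesSum_mul_eval_mul_wgt a b B G hq]
  rw [integral_finsetSum _ fun i _ => (integrableOn_rodriguesSum_mul_pow hab hB hG n i).const_mul _,
    Finset.sum_range_succ, Finset.sum_eq_zero, zero_add, integral_const_mul,
    integral_rodriguesSum_mul_pow hab hB hG le_rfl, if_pos rfl]
  intro i hi
  rw [integral_const_mul, integral_rodriguesSum_mul_pow hab hB hG (Finset.mem_range.1 hi).le,
    if_neg (Finset.mem_range.1 hi).ne, mul_zero]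

open Polynomial in
/-- `rodriguesSum` as a polynomial in `x - a`. -/
noncomputable def rodriguesPoly (L B G : ℝ) (n : ℕ) : ℝ[X] :=
  ∑ k ∈ Finset.range (n + 1), C (rodriguesCoeff B G n k) * (X ^ (n - k) * (C (-1) * X + C L) ^ k)

theorem eval_rodriguesPoly (a b B G : ℝ) (n : ℕ) (x : ℝ) :
    (rodriguesPoly (b - a) B G n).eval (x - a) = rodriguesSum a b B G n x := by
  rw [rodriguesPoly, rodriguesSum, Polynomial.eval_finsetSum]
  refine Finset.sum_congr rfl fun k _ => ?_
  simp only [Polynomial.eval_mul, Polynomial.eval_pow, Polynomial.eval_add, Polynomial.eval_C,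
    Polynomial.eval_X]
  rw [show -1 * (x - a) + (b - a) = b - x by ring]
  ring

theorem natDegree_X_pow_mul_linear_pow_le (L : ℝ) {n k : ℕ} (hk : k ≤ n) :
    (Polynomial.X ^ (n - k) * (Polynomial.C (-1) * Polynomial.X + Polynomial.C L) ^ k :
      Polynomial ℝ).natDegree ≤ n := by
  refine Polynomial.natDegree_mul_le.trans ?_
  rw [Polynomial.natDegree_X_pow]
  have := Polynomial.natDegree_pow_le_of_le (p := Polynomial.C (-1 : ℝ) * Polynomial.X +
    Polynomial.C L) k Polynomial.natDegree_linear_le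
  omega

theorem natDegree_rodriguesPoly_le (L B G : ℝ) (n : ℕ) : (rodriguesPoly L B G n).natDegree ≤ n :=
  Polynomial.natDegree_sum_le_of_forall_le _ _ fun _ hk =>
    (Polynomial.natDegree_C_mul_le _ _).trans
      (natDegree_X_pow_mul_linear_pow_le L (Nat.lt_succ_iff.1 (Finset.mem_range.1 hk)))

theorem coeff_rodriguesPoly (L B G : ℝ) (n : ℕ) :
    (rodriguesPoly L B G n).coeff n = (-1) ^ n * ∏ j ∈ Finset.range n, (B + G + (2 * n : ℕ) - j) := by
  have hk : ∀ k ∈ Finset.range (n + 1), (Polynomial.C (rodriguesCoeff B G n k) *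
      (Polynomial.X ^ (n - k) * (Polynomial.C (-1) * Polynomial.X + Polynomial.C L) ^ k)).coeff n =
      (-1) ^ n * ((n.choose k : ℝ) * ((∏ j ∈ Finset.range k, (B + n - j)) *
        ∏ j ∈ Finset.range (n - k), (G + n - j))) := by
    intro k hk
    have hkn : k ≤ n := Nat.lt_succ_iff.1 (Finset.mem_range.1 hk)
    have h1 : (Polynomial.C (-1 : ℝ) * Polynomial.X + Polynomial.C L).natDegree ≤ 1 :=
      Polynomial.natDegree_linear_le
    have h2 := Polynomial.coeff_pow_of_natDegree_le (m := k) h1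
    rw [mul_one] at h2
    rw [Polynomial.coeff_C_mul, Polynomial.coeff_X_pow_mul', if_pos (Nat.sub_le _ _),
      Nat.sub_sub_self hkn, h2, rodriguesCoeff]
    obtain ⟨l, rfl⟩ := Nat.exists_eq_add_of_le hkn
    simp
    ring
  rw [rodriguesPoly, Polynomial.finsetSum_coeff, Finset.sum_congr rfl hk, ← Finset.mul_sum,
    sum_choose_mul_prod_sub_mul_prod_sub]
  congr 1
  refine Finset.prod_congr rfl fun j _ => ?_
  push_cast
  ring

theorem integrableOn_rodriguesSum_sq {a b B G : ℝ} (hab : a < b) (hB : -1 < B) (hG : -1 < G)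
    (n : ℕ) : IntegrableOn (fun x => rodriguesSum a b B G n x ^ 2 * wgt a b B G x) (Ioo a b) := by
  simpa only [eval_rodriguesPoly, ← sq] using
    integrableOn_rodriguesSum_mul_eval hab hB hG (natDegree_rodriguesPoly_le (b - a) B G n)

theorem integral_rodriguesSum_sq {a b B G : ℝ} (hab : a < b) (hB : -1 < B) (hG : -1 < G)
    {n : ℕ} (hn : 1 ≤ n) :
    ∫ x in Ioo a b, rodriguesSum a b B G n x ^ 2 * wgt a b B G x =
      (b - a) ^ (B + G + (2 * n : ℕ) + 1) * ((n.factorial : ℝ) * Real.Gamma (B + n + 1) *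
        Real.Gamma (G + n + 1)) / ((B + G + 2 * n + 1) * Real.Gamma (B + G + n + 1)) := by
  have hn' : (1 : ℝ) ≤ n := by exact_mod_cast hn
  have h := integral_rodriguesSum_mul_eval hab hB hG (natDegree_rodriguesPoly_le (b - a) B G n)
  simp only [eval_rodriguesPoly, ← sq] at h
  rw [h, coeff_rodriguesPoly]
  have hG1 := prod_sub_mul_Gamma (B + G + (2 * n : ℕ)) n (by push_cast; linarith)
  rw [show B + G + ((2 * n : ℕ) : ℝ) - n + 1 = B + G + n + 1 by push_cast; ring] at hG1
  have hG2 : Real.Gamma (B + G + (2 * n : ℕ) + 2) =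
      (B + G + 2 * n + 1) * Real.Gamma (B + G + (2 * n : ℕ) + 1) := by
    rw [show B + G + ((2 * n : ℕ) : ℝ) + 2 = (B + G + (2 * n : ℕ) + 1) + 1 by ring,
      Real.Gamma_add_one (by push_cast; linarith)]
    push_cast
    ring
  have hpos1 : 0 < Real.Gamma (B + G + n + 1) := Real.Gamma_pos_of_pos (by linarith)
  have hpos2 : 0 < Real.Gamma (B + G + (2 * n : ℕ) + 1) :=
    Real.Gamma_pos_of_pos (by push_cast; linarith)
  have hpos3 : 0 < B + G + 2 * n + 1 := by linarith
  have hprod : (∏ j ∈ Finset.range n, (B + G + ((2 * n : ℕ) : ℝ) - j)) =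
      Real.Gamma (B + G + (2 * n : ℕ) + 1) / Real.Gamma (B + G + n + 1) := by
    rw [eq_div_iff hpos1.ne', hG1]
  have hsign : ((-1 : ℝ) ^ n) ^ 2 = 1 := by rw [← pow_mul, mul_comm, pow_mul]; simp
  rw [hprod, hG2]
  field_simp
  rw [hsign, one_mul]

theorem jacobiDelta_sq {a b B G : ℝ} (hab : a < b) (hB : -1 < B) (hG : -1 < G)
    {n : ℕ} (hn : 1 ≤ n) :
    jacobiDelta a b B G n ^ 2 = ((B + G + 2 * n + 1) * Real.Gamma (B + G + n + 1)) /
      ((b - a) ^ (B + G + (2 * n : ℕ) + 1) * ((n.factorial : ℝ) * Real.Gamma (B + n + 1) *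
        Real.Gamma (G + n + 1))) := by
  have hn' : (1 : ℝ) ≤ n := by exact_mod_cast hn
  have hpos1 : 0 < Real.Gamma (B + G + n + 1) := Real.Gamma_pos_of_pos (by linarith)
  have hpos2 : 0 < Real.Gamma (B + n + 1) := Real.Gamma_pos_of_pos (by linarith)
  have hpos3 : 0 < Real.Gamma (G + n + 1) := Real.Gamma_pos_of_pos (by linarith)
  have hpos4 : 0 < B + G + 2 * n + 1 := by linarith
  have hL : 0 < b - a := sub_pos.2 hab
  have hsign : ((-1 : ℝ) ^ n) ^ 2 = 1 := by rw [← pow_mul, mul_comm, pow_mul]; simp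
  have hpow : ((b - a) ^ ((n : ℝ) + (B + G + 1) / 2)) ^ 2 =
      (b - a) ^ (B + G + (2 * n : ℕ) + 1) := by
    rw [← Real.rpow_natCast, ← Real.rpow_mul hL.le]
    congr 1
    push_cast
    ring
  rw [jacobiDelta, mul_pow, div_pow, hsign, Real.sq_sqrt (by positivity), hpow, div_mul_div_comm,
    one_mul]

theorem integrableOn_jacobiP_sq {a b B G : ℝ} (hab : a < b) (hB : -1 < B) (hG : -1 < G)
    (n : ℕ) : IntegrableOn (fun x => jacobiP a b B G n x ^ 2 * wgt a b B G x) (Ioo a b) := by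
  simpa only [jacobiP_eq, mul_pow, mul_assoc, IntegrableOn] using
    (integrableOn_rodriguesSum_sq hab hB hG n).const_mul (jacobiDelta a b B G n ^ 2)

/-- Jacobi polynomials of positive degree are normalized. -/
theorem integral_jacobiP_sq {a b B G : ℝ} (hab : a < b) (hB : -1 < B) (hG : -1 < G)
    {n : ℕ} (hn : 1 ≤ n) : ∫ x in Ioo a b, jacobiP a b B G n x ^ 2 * wgt a b B G x = 1 := by
  have hn' : (1 : ℝ) ≤ n := by exact_mod_cast hn
  have hpos1 : 0 < Real.Gamma (B + G + n + 1) := Real.Gamma_pos_of_pos (by linarith)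
  have hpos2 : 0 < Real.Gamma (B + n + 1) := Real.Gamma_pos_of_pos (by linarith)
  have hpos3 : 0 < Real.Gamma (G + n + 1) := Real.Gamma_pos_of_pos (by linarith)
  have hpos4 : 0 < B + G + 2 * n + 1 := by linarith
  have hL : 0 < (b - a) ^ (B + G + (2 * n : ℕ) + 1) := Real.rpow_pos_of_pos (sub_pos.2 hab) _
  simp only [jacobiP_eq, mul_pow, mul_assoc]
  rw [integral_const_mul, integral_rodriguesSum_sq hab hB hG hn, jacobiDelta_sq hab hB hG hn]
  field_simp

theorem wgt_nonneg {a b B G x : ℝ} (hx : x ∈ Ioo a b) : 0 ≤ wgt a b B G x :=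
  mul_nonneg (Real.rpow_nonneg (sub_nonneg.2 hx.1.le) _)
    (Real.rpow_nonneg (sub_nonneg.2 hx.2.le) _)

theorem exists_lintegral_jacobiP_sq_le {a b B G : ℝ} (hab : a < b) (hB : -1 < B) (hG : -1 < G) :
    ∃ N : ℝ, ∀ n : ℕ,
      ∫⁻ x in Ioo a b, ENNReal.ofReal (jacobiP a b B G n x ^ 2 * wgt a b B G x) ≤
        ENNReal.ofReal N := by
  refine ⟨max 1 (∫ x in Ioo a b, jacobiP a b B G 0 x ^ 2 * wgt a b B G x), fun n => ?_⟩
  rw [← ofReal_integral_eq_lintegral_ofReal (integrableOn_jacobiP_sq hab hB hG n)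
    (ae_restrict_of_forall_mem measurableSet_Ioo fun x hx =>
      mul_nonneg (sq_nonneg _) (wgt_nonneg hx))]
  refine ENNReal.ofReal_le_ofReal ?_
  rcases n.eq_zero_or_pos with rfl | hn
  · exact le_max_right _ _
  · exact (integral_jacobiP_sq hab hB hG hn).trans_le (le_max_left _ _)

theorem rpow_add_le_mul_rpow {u s p q : ℝ} (hu : 0 < u) (hs : 0 < s) (hp : p ≤ 0) (hq : q ≤ 0) :
    (u + s) ^ (p + q) ≤ s ^ p * u ^ q := by
  rw [Real.rpow_add (add_pos hu hs)]
  exact mul_le_mul (Real.rpow_le_rpow_of_nonpos hs (by linarith) hp)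
    (Real.rpow_le_rpow_of_nonpos hu (by linarith) hq)
    (Real.rpow_nonneg (add_pos hu hs).le _) (Real.rpow_nonneg hs.le _)

theorem lintegral_le_of_le_rpow_mul_rpow {c d p q K M : ℝ} {F : ℝ → ℝ} (hcd : c < d) (hp : 0 < p)
    (hq : 0 < q) (hK : 0 ≤ K)
    (hF : ∀ x ∈ Ioo c d, F x ≤ K * ((x - c) ^ (p - 1) * (d - x) ^ (q - 1)))
    (hM : K * ((d - c) ^ (p + q - 1) * ProbabilityTheory.beta p q) ≤ M) :
    ∫⁻ x in Ioo c d, ENNReal.ofReal (F x) ≤ ENNReal.ofReal M := by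
  refine (setLIntegral_mono' measurableSet_Ioo
    fun x hx => ENNReal.ofReal_le_ofReal (hF x hx)).trans ?_
  simp_rw [ENNReal.ofReal_mul hK]
  rw [lintegral_const_mul' _ _ ENNReal.ofReal_ne_top, lintegral_rpow_mul_rpow_Ioo hcd hp hq,
    ← ENNReal.ofReal_mul hK]
  exact ENNReal.ofReal_le_ofReal hM

/-- The correlation of the two weights at distance `s` is `O(s ^ (-(δ₁ + δ₂)))`. -/
theorem exists_lintegral_wgt_mul_wgt_le {a b β γ δ₁ δ₂ : ℝ}
    (hab : a < b) (hβ0 : 0 < β) (hβ1 : β < 1) (hβγ : β ≤ γ)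
    (hδ₁ : 0 < δ₁) (hδ₂ : 0 < δ₂) (hδ₁β : δ₁ + β ≤ 1) (hδ₂γ : δ₂ ≤ γ) :
    ∃ C : ℝ, 0 ≤ C ∧ ∀ s ∈ Ioo 0 (b - a),
      ∫⁻ x in Ioo (a + s) b,
        ENNReal.ofReal (wgt a b (-β) (-γ) (x - s) * wgt a b (β - 1) (γ - 1) x) ≤
      ENNReal.ofReal (C * s ^ (-(δ₁ + δ₂))) := by
  have hL : 0 < b - a := sub_pos.2 hab
  have hL2 : 0 < (b - a) / 2 := half_pos hL
  have hγ : 0 < γ := hβ0.trans_le hβγ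
  have hβ' : 0 < 1 - β := sub_pos.2 hβ1
  have hb1 := (ProbabilityTheory.beta_pos hδ₁ hδ₂).le
  have hb2 := (ProbabilityTheory.beta_pos hβ' hγ).le
  set A := ((b - a) ^ (δ₁ + δ₂ - 1) + ((b - a) / 2) ^ (δ₁ + δ₂ - 1)) *
    ProbabilityTheory.beta δ₁ δ₂ with hA
  set D := ((b - a) / 2) ^ (β - 1 - γ + (δ₁ + δ₂)) *
    ((b - a) ^ (γ - β) * ProbabilityTheory.beta (1 - β) γ) with hD
  have hA0 : 0 ≤ A := by positivity
  have hD0 : 0 ≤ D := by positivity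
  refine ⟨A + D, add_nonneg hA0 hD0, fun s hs => ?_⟩
  have hs0 : 0 < s := hs.1
  have hcd : a + s < b := by linarith [hs.2]
  have hform (x : ℝ) : wgt a b (-β) (-γ) (x - s) * wgt a b (β - 1) (γ - 1) x =
      ((x - (a + s)) ^ (-β) * (b - x) ^ (γ - 1)) *
        ((x - (a + s) + s) ^ (β - 1) * (b - x + s) ^ (-γ)) := by
    rw [wgt, wgt, show x - s - a = x - (a + s) by ring, show b - (x - s) = b - x + s by ring,
      show x - (a + s) + s = x - a by ring]
    ring
  have hsk : 0 < s ^ (-(δ₁ + δ₂)) := Real.rpow_pos_of_pos hs0 _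
  rcases le_or_gt s ((b - a) / 2) with hs2 | hs2
  · refine lintegral_le_of_le_rpow_mul_rpow hcd hδ₁ hδ₂ hsk.le (fun x hx => ?_) ?_
    · have hu : 0 < x - (a + s) := sub_pos.2 hx.1
      have hv : 0 < b - x := sub_pos.2 hx.2
      have h1 := rpow_add_le_mul_rpow (p := -δ₁) (q := β - 1 + δ₁) hu hs0 (by linarith)
        (by linarith)
      have h2 := rpow_add_le_mul_rpow (p := -δ₂) (q := δ₂ - γ) hv hs0 (by linarith) (by linarith)
      rw [show -δ₁ + (β - 1 + δ₁) = β - 1 by ring] at h1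
      rw [show -δ₂ + (δ₂ - γ) = -γ by ring] at h2
      rw [hform]
      calc _ ≤ ((x - (a + s)) ^ (-β) * (b - x) ^ (γ - 1)) *
            ((s ^ (-δ₁) * (x - (a + s)) ^ (β - 1 + δ₁)) * (s ^ (-δ₂) * (b - x) ^ (δ₂ - γ))) := by
            gcongr
        _ = _ := by
            rw [show δ₁ - 1 = -β + (β - 1 + δ₁) by ring, show δ₂ - 1 = (γ - 1) + (δ₂ - γ) by ring,
              show -(δ₁ + δ₂) = -δ₁ + -δ₂ by ring, Real.rpow_add hs0,
              Real.rpow_add hu (-β), Real.rpow_add hv (γ - 1)]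
            ring
    · have hpow : (b - (a + s)) ^ (δ₁ + δ₂ - 1) ≤
          (b - a) ^ (δ₁ + δ₂ - 1) + ((b - a) / 2) ^ (δ₁ + δ₂ - 1) := by
        rcases le_total 0 (δ₁ + δ₂ - 1) with h | h
        · exact (Real.rpow_le_rpow (by linarith) (by linarith) h).trans
            (le_add_of_nonneg_right (by positivity))
        · exact (Real.rpow_le_rpow_of_nonpos hL2 (by linarith) h).trans
            (le_add_of_nonneg_left (by positivity))
      rw [mul_comm (A + D)]
      refine mul_le_mul_of_nonneg_left ?_ hsk.le
      exact (mul_le_mul_of_nonneg_right hpow hb1).trans (le_add_of_nonneg_right hD0)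
  · refine lintegral_le_of_le_rpow_mul_rpow hcd hβ' hγ
      (K := s ^ (β - 1 - γ)) (Real.rpow_nonneg hs0.le _) (fun x hx => ?_) ?_
    · have hu : 0 < x - (a + s) := sub_pos.2 hx.1
      have hv : 0 < b - x := sub_pos.2 hx.2
      have h1 : (x - (a + s) + s) ^ (β - 1) ≤ s ^ (β - 1) :=
        Real.rpow_le_rpow_of_nonpos hs0 (by linarith) (by linarith)
      have h2 : (b - x + s) ^ (-γ) ≤ s ^ (-γ) :=
        Real.rpow_le_rpow_of_nonpos hs0 (by linarith) (by linarith)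
      rw [hform, show 1 - β - 1 = -β by ring, sub_eq_add_neg (β - 1) γ, Real.rpow_add hs0,
        mul_comm]
      gcongr
    · have h1 : (b - (a + s)) ^ (1 - β + γ - 1) ≤ (b - a) ^ (γ - β) := by
        rw [show 1 - β + γ - 1 = γ - β by ring]
        exact Real.rpow_le_rpow (by linarith) (by linarith) (by linarith)
      have h2 : s ^ (β - 1 - γ + (δ₁ + δ₂)) ≤ ((b - a) / 2) ^ (β - 1 - γ + (δ₁ + δ₂)) :=
        Real.rpow_le_rpow_of_nonpos hL2 hs2.le (by linarith)
      have h3 : s ^ (β - 1 - γ) = s ^ (-(δ₁ + δ₂)) * s ^ (β - 1 - γ + (δ₁ + δ₂)) := by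
        rw [← Real.rpow_add hs0]
        congr 1
        ring
      rw [h3, mul_assoc, mul_comm (A + D)]
      refine mul_le_mul_of_nonneg_left (le_trans ?_ (le_add_of_nonneg_left hA0)) hsk.le
      rw [hD]
      gcongr

theorem measurable_wgt (a b B G : ℝ) : Measurable (wgt a b B G) :=
  measurable_rpow_mul_rpow a b B G

theorem measurable_rodriguesSum (a b B G : ℝ) (n : ℕ) : Measurable (rodriguesSum a b B G n) := by
  unfold rodriguesSum
  fun_prop

theorem measurable_jacobiP (a b B G : ℝ) (n : ℕ) : Measurable (jacobiP a b B G n) :=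
  (measurable_rodriguesSum a b B G n).const_mul _

/-- Cauchy-Schwarz inequality, with square roots inside the integral. -/
theorem lintegral_sqrt_mul_le {α : Type*} [MeasurableSpace α] {μ : Measure α}
    {F G : α → ENNReal} (hF : AEMeasurable F μ) (hG : AEMeasurable G μ) :
    ∫⁻ x, (F x * G x) ^ (1 / 2 : ℝ) ∂μ ≤
      (∫⁻ x, F x ∂μ) ^ (1 / 2 : ℝ) * (∫⁻ x, G x ∂μ) ^ (1 / 2 : ℝ) := by
  have h := ENNReal.lintegral_mul_le_Lp_mul_Lq μ Real.HolderConjugate.two_two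
    (hF.pow_const (1 / 2 : ℝ)) (hG.pow_const (1 / 2 : ℝ))
  have hsq (y : ENNReal) : (y ^ (1 / 2 : ℝ)) ^ (2 : ℝ) = y := by
    rw [← ENNReal.rpow_mul]
    norm_num
  simpa only [Pi.mul_apply, hsq,
    ← ENNReal.mul_rpow_of_nonneg _ _ (show (0 : ℝ) ≤ 1 / 2 by norm_num)] using h

/-- The squared norm of `t ↦ θ (x - t)` in the dual of the weighted space on `(a, x)`. -/
noncomputable def dualNormSq (a b β γ : ℝ) (θ : ℝ → ℝ) (x : ℝ) : ENNReal :=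
  ∫⁻ t in Ioo a x, ENNReal.ofReal (θ (x - t) ^ 2 * wgt a b (-β) (-γ) t)

theorem dualNormSq_eq (a b β γ : ℝ) (θ : ℝ → ℝ) (x : ℝ) :
    dualNormSq a b β γ θ x = ∫⁻ s, {p : ℝ × ℝ | 0 < p.2 ∧ a + p.2 < p.1}.indicator
      (fun p => ENNReal.ofReal (θ p.2 ^ 2 * wgt a b (-β) (-γ) (p.1 - p.2))) (x, s) := by
  rw [dualNormSq, ← lintegral_indicator measurableSet_Ioo, ← lintegral_sub_left_eq_self _ x]
  refine lintegral_congr fun s => ?_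
  have hmem : x - s ∈ Ioo a x ↔ (x, s) ∈ {p : ℝ × ℝ | 0 < p.2 ∧ a + p.2 < p.1} := by
    simp only [mem_Ioo, mem_ofPred_eq]
    constructor <;> rintro ⟨h1, h2⟩ <;> constructor <;> linarith
  by_cases h : x - s ∈ Ioo a x
  · rw [indicator_of_mem h, indicator_of_mem (hmem.1 h), sub_sub_cancel]
  · rw [indicator_of_notMem h, indicator_of_notMem (mt hmem.2 h)]

theorem measurable_dualNormSq_integrand (a b β γ : ℝ) {θ : ℝ → ℝ} (hθ : Measurable θ) :
    Measurable ({p : ℝ × ℝ | 0 < p.2 ∧ a + p.2 < p.1}.indicator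
      (fun p => ENNReal.ofReal (θ p.2 ^ 2 * wgt a b (-β) (-γ) (p.1 - p.2)))) := by
  have hw := measurable_wgt a b (-β) (-γ)
  refine Measurable.indicator (by fun_prop) ?_
  exact (measurableSet_lt measurable_const measurable_snd).inter
    (measurableSet_lt (by fun_prop) measurable_fst)

theorem measurable_dualNormSq (a b β γ : ℝ) {θ : ℝ → ℝ} (hθ : Measurable θ) :
    Measurable (dualNormSq a b β γ θ) := by
  simp only [funext (dualNormSq_eq a b β γ θ)]
  exact (measurable_dualNormSq_integrand a b β γ hθ).lintegral_prod_right'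

/-- The Sonin operator has finite Hilbert-Schmidt norm between the weighted spaces. -/
theorem lintegral_wgt_mul_dualNormSq_lt_top {a b β γ δ₁ δ₂ : ℝ} {θ : ℝ → ℝ}
    (hab : a < b) (hβ0 : 0 < β) (hβ1 : β < 1) (hβγ : β ≤ γ)
    (hδ₁ : 0 < δ₁) (hδ₂ : 0 < δ₂) (hδ₁β : δ₁ + β ≤ 1) (hδ₂γ : δ₂ ≤ γ) (hθ : Measurable θ)
    (hθw : ∫⁻ t in Ioo 0 (b - a), ENNReal.ofReal (θ t ^ 2 * t ^ (-(δ₁ + δ₂))) < ⊤) :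
    ∫⁻ x in Ioo a b, ENNReal.ofReal (wgt a b (β - 1) (γ - 1) x) * dualNormSq a b β γ θ x < ⊤ := by
  obtain ⟨C, hC, hCs⟩ :=
    exists_lintegral_wgt_mul_wgt_le hab hβ0 hβ1 hβγ hδ₁ hδ₂ hδ₁β hδ₂γ
  have hmeas := measurable_dualNormSq_integrand a b β γ hθ
  have hw := measurable_wgt a b (β - 1) (γ - 1)
  simp only [dualNormSq_eq]
  simp_rw [← lintegral_const_mul' _ _ ENNReal.ofReal_ne_top]
  rw [lintegral_lintegral_swap (by
    refine Measurable.aemeasurable ?_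
    exact (hw.comp measurable_fst).ennreal_ofReal.mul hmeas)]
  have hle : ∀ s, ∫⁻ x in Ioo a b, ENNReal.ofReal (wgt a b (β - 1) (γ - 1) x) *
      {p : ℝ × ℝ | 0 < p.2 ∧ a + p.2 < p.1}.indicator
        (fun p => ENNReal.ofReal (θ p.2 ^ 2 * wgt a b (-β) (-γ) (p.1 - p.2))) (x, s) ≤
      (Ioo 0 (b - a)).indicator
        (fun s => ENNReal.ofReal C * ENNReal.ofReal (θ s ^ 2 * s ^ (-(δ₁ + δ₂)))) s := by
    intro s
    by_cases hs : s ∈ Ioo 0 (b - a)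
    · rw [indicator_of_mem hs]
      calc _ ≤ ∫⁻ x in Ioo (a + s) b, ENNReal.ofReal (θ s ^ 2) *
            ENNReal.ofReal (wgt a b (-β) (-γ) (x - s) * wgt a b (β - 1) (γ - 1) x) := by
            rw [← lintegral_indicator measurableSet_Ioo, ← lintegral_indicator measurableSet_Ioo]
            refine lintegral_mono fun x => ?_
            by_cases hx : x ∈ Ioo (a + s) b
            · have hx' : x ∈ Ioo a b := ⟨by linarith [hx.1, hs.1], hx.2⟩
              have hmem : (x, s) ∈ {p : ℝ × ℝ | 0 < p.2 ∧ a + p.2 < p.1} := ⟨hs.1, hx.1⟩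
              rw [indicator_of_mem hx, indicator_of_mem hx', indicator_of_mem hmem,
                ← ENNReal.ofReal_mul (wgt_nonneg hx'), ← ENNReal.ofReal_mul (sq_nonneg _)]
              exact ENNReal.ofReal_le_ofReal (by linarith)
            · rw [indicator_of_notMem hx]
              by_cases hx' : x ∈ Ioo a b
              · rw [indicator_of_mem hx', indicator_of_notMem, mul_zero]
                exact fun h => hx ⟨h.2, hx'.2⟩
              · rw [indicator_of_notMem hx']
        _ ≤ ENNReal.ofReal (θ s ^ 2) * ENNReal.ofReal (C * s ^ (-(δ₁ + δ₂))) := by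
            rw [lintegral_const_mul' _ _ ENNReal.ofReal_ne_top]
            gcongr
            exact hCs s hs
        _ = _ := by
            rw [← ENNReal.ofReal_mul (sq_nonneg _), ← ENNReal.ofReal_mul hC]
            congr 1
            ring
    · rw [indicator_of_notMem hs, nonpos_iff_eq_zero]
      refine setLIntegral_eq_zero measurableSet_Ioo fun x hx => ?_
      rw [indicator_of_notMem]
      · simp
      · exact fun h => hs ⟨h.1, by linarith [h.2, hx.2]⟩
  refine (lintegral_mono hle).trans_lt ?_
  rw [lintegral_indicator measurableSet_Ioo, lintegral_const_mul' _ _ ENNReal.ofReal_ne_top]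
  exact ENNReal.mul_lt_top ENNReal.ofReal_lt_top hθw

theorem enorm_integral_mul_le {a b β γ : ℝ} {θ f : ℝ → ℝ} {x : ℝ} (hx : x ∈ Ioo a b)
    (hθ : Measurable θ) (hf : AEStronglyMeasurable f (volume.restrict (Ioo a b))) :
    ‖∫ t in Ioo a x, θ (x - t) * f t‖ₑ ≤
      (∫⁻ t in Ioo a b, ENNReal.ofReal (|f t| ^ (2 : ℝ) * wgt a b β γ t)) ^ (1 / 2 : ℝ) *
        dualNormSq a b β γ θ x ^ (1 / 2 : ℝ) := by
  have hsub : Ioo a x ⊆ Ioo a b := Ioo_subset_Ioo_right hx.2.le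
  have hw := measurable_wgt a b β γ
  have hw' := measurable_wgt a b (-β) (-γ)
  have hf' : AEMeasurable f (volume.restrict (Ioo a x)) :=
    (hf.mono_measure (Measure.restrict_mono_set volume hsub)).aemeasurable
  calc _ ≤ ∫⁻ t in Ioo a x, ‖θ (x - t) * f t‖ₑ := enorm_integral_le_lintegral_enorm _
    _ = ∫⁻ t in Ioo a x, (ENNReal.ofReal (|f t| ^ (2 : ℝ) * wgt a b β γ t) *
          ENNReal.ofReal (θ (x - t) ^ 2 * wgt a b (-β) (-γ) t)) ^ (1 / 2 : ℝ) := by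
        refine setLIntegral_congr_fun measurableSet_Ioo fun t ht => ?_
        have ht' := hsub ht
        have hinv : wgt a b β γ t * wgt a b (-β) (-γ) t = 1 := by
          have h1 : 0 < t - a := sub_pos.2 ht'.1
          have h2 : 0 < b - t := sub_pos.2 ht'.2
          rw [wgt, wgt, mul_mul_mul_comm, ← Real.rpow_add h1, ← Real.rpow_add h2]
          simp
        have hprod : |f t| ^ (2 : ℝ) * wgt a b β γ t * (θ (x - t) ^ 2 * wgt a b (-β) (-γ) t) =
            |θ (x - t) * f t| ^ (2 : ℝ) := by
          rw [Real.rpow_two, Real.rpow_two, sq_abs, sq_abs]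
          linear_combination (f t) ^ 2 * θ (x - t) ^ 2 * hinv
        rw [← ENNReal.ofReal_mul (mul_nonneg (by positivity) (wgt_nonneg ht')), hprod,
          ENNReal.ofReal_rpow_of_nonneg (by positivity) (by norm_num),
          ← Real.rpow_mul (abs_nonneg _), Real.enorm_eq_ofReal_abs]
        norm_num
    _ ≤ (∫⁻ t in Ioo a x, ENNReal.ofReal (|f t| ^ (2 : ℝ) * wgt a b β γ t)) ^ (1 / 2 : ℝ) *
          dualNormSq a b β γ θ x ^ (1 / 2 : ℝ) := by
        refine lintegral_sqrt_mul_le ?_ (by fun_prop)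
        simp only [Real.rpow_two, sq_abs]
        exact ((hf'.pow_const 2).mul hw.aemeasurable).ennreal_ofReal
    _ ≤ _ := by gcongr

theorem wLpNorm_two_eq {a b β γ : ℝ} {f : ℝ → ℝ}
    (hf : AEStronglyMeasurable f (volume.restrict (Ioo a b))) :
    wLpNorm a b β γ 2 f =
      ((∫⁻ t in Ioo a b, ENNReal.ofReal (|f t| ^ (2 : ℝ) * wgt a b β γ t)) ^ (1 / 2 : ℝ)).toReal := by
  rw [wLpNorm, integral_eq_lintegral_of_nonneg_ae, ENNReal.toReal_rpow]
  · exact ae_restrict_of_forall_mem measurableSet_Ioo fun x hx =>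
      mul_nonneg (by positivity) (wgt_nonneg hx)
  · simp only [Real.rpow_two, sq_abs]
    exact (hf.pow 2).mul (measurable_wgt a b β γ).aestronglyMeasurable

/-- Lemma 2: uniform bound for the Jacobi coefficients of `I^ϑ_{a+} f`. -/
theorem jacobi_coef_uniform_bound
    (a b β γ δ₁ δ₂ : ℝ) (ϑ : ℝ → ℝ)
    (hab : a < b) (hβ0 : 0 < β) (hβ1 : β < 1) (hβγ : β ≤ γ)
    (hδ₁ : 0 < δ₁) (hδ₂ : 0 < δ₂) (hδ₁β : δ₁ + β ≤ 1) (hδ₂γ : δ₂ ≤ γ)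
    (hϑmeas : AEStronglyMeasurable ϑ (volume.restrict (Ioo 0 (b - a))))
    (hϑw : IntegrableOn (fun t => ϑ t ^ 2 * t ^ (-(δ₁ + δ₂))) (Ioo 0 (b - a))) :
    ∃ C : ℝ, ∀ m : ℕ, ∀ f : ℝ → ℝ, MemWLp a b β γ 2 f →
      |∫ x in Ioo a b, jacobiP a b (β - 1) (γ - 1) m x *
          (∫ t in a..x, ϑ (x - t) * f t) * wgt a b (β - 1) (γ - 1) x| ≤
        C * wLpNorm a b β γ 2 f := by
  obtain ⟨N, hN⟩ := exists_lintegral_jacobiP_sq_le (B := β - 1) (G := γ - 1) hab (by linarith)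
    (by linarith)
  set θ := hϑmeas.mk ϑ
  have hθ : Measurable θ := hϑmeas.stronglyMeasurable_mk.measurable
  have hae : ϑ =ᵐ[volume.restrict (Ioo 0 (b - a))] θ := hϑmeas.ae_eq_mk
  have hθw : ∫⁻ t in Ioo 0 (b - a), ENNReal.ofReal (θ t ^ 2 * t ^ (-(δ₁ + δ₂))) < ⊤ := by
    have h : ∫⁻ t in Ioo 0 (b - a), ENNReal.ofReal (ϑ t ^ 2 * t ^ (-(δ₁ + δ₂))) =
        ∫⁻ t in Ioo 0 (b - a), ENNReal.ofReal (θ t ^ 2 * t ^ (-(δ₁ + δ₂))) :=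
      lintegral_congr_ae (hae.mono fun t ht => by simp only [ht])
    rw [← h, ← hasFiniteIntegral_iff_ofReal (ae_restrict_of_forall_mem measurableSet_Ioo fun t ht =>
        mul_nonneg (sq_nonneg _) (Real.rpow_nonneg ht.1.le _))]
    exact hϑw.2
  have hHS := lintegral_wgt_mul_dualNormSq_lt_top hab hβ0 hβ1 hβγ hδ₁ hδ₂ hδ₁β hδ₂γ hθ hθw
  set S := ∫⁻ x in Ioo a b, ENNReal.ofReal (wgt a b (β - 1) (γ - 1) x) * dualNormSq a b β γ θ x
  have hconv : ∀ f : ℝ → ℝ, ∀ x ∈ Ioo a b,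
      ∫ t in a..x, ϑ (x - t) * f t = ∫ t in Ioo a x, θ (x - t) * f t := by
    intro f x hx
    rw [intervalIntegral.integral_of_le hx.1.le, integral_Ioc_eq_integral_Ioo]
    refine integral_congr_ae ((ae_restrict_iff' measurableSet_Ioo).2 ?_)
    filter_upwards [(Measure.measurePreserving_sub_left volume x).quasiMeasurePreserving.ae
      ((ae_restrict_iff' measurableSet_Ioo).1 hae)] with t ht htx
    rw [ht ⟨by linarith [htx.2], by linarith [htx.1, hx.2]⟩]
  refine ⟨(ENNReal.ofReal N ^ (1 / 2 : ℝ) * S ^ (1 / 2 : ℝ)).toReal, fun m f hf => ?_⟩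
  rw [wLpNorm_two_eq hf.1, ← ENNReal.toReal_mul, ← Real.norm_eq_abs, ← toReal_enorm]
  set F := (∫⁻ t in Ioo a b, ENNReal.ofReal (|f t| ^ (2 : ℝ) * wgt a b β γ t)) ^ (1 / 2 : ℝ)
    with hF
  have hFtop : F ≠ ⊤ := ENNReal.rpow_ne_top_of_nonneg (by norm_num) hf.2.ne
  have hw := measurable_wgt a b (β - 1) (γ - 1)
  have hp := measurable_jacobiP a b (β - 1) (γ - 1) m
  have hd := measurable_dualNormSq a b β γ hθ
  refine ENNReal.toReal_mono (ENNReal.mul_ne_top (ENNReal.mul_ne_top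
    (ENNReal.rpow_ne_top_of_nonneg (by norm_num) ENNReal.ofReal_ne_top)
    (ENNReal.rpow_ne_top_of_nonneg (by norm_num) hHS.ne)) hFtop) ?_
  calc _ ≤ ∫⁻ x in Ioo a b, ‖jacobiP a b (β - 1) (γ - 1) m x *
          (∫ t in a..x, ϑ (x - t) * f t) * wgt a b (β - 1) (γ - 1) x‖ₑ :=
        enorm_integral_le_lintegral_enorm _
    _ ≤ ∫⁻ x in Ioo a b, F *
          (ENNReal.ofReal (jacobiP a b (β - 1) (γ - 1) m x ^ 2 * wgt a b (β - 1) (γ - 1) x) *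
            (ENNReal.ofReal (wgt a b (β - 1) (γ - 1) x) * dualNormSq a b β γ θ x)) ^
              (1 / 2 : ℝ) := by
        refine setLIntegral_mono' measurableSet_Ioo fun x hx => ?_
        have hw0 : 0 ≤ wgt a b (β - 1) (γ - 1) x := wgt_nonneg hx
        have hsq : ‖jacobiP a b (β - 1) (γ - 1) m x‖ₑ * ‖wgt a b (β - 1) (γ - 1) x‖ₑ =
            (ENNReal.ofReal (jacobiP a b (β - 1) (γ - 1) m x ^ 2 * wgt a b (β - 1) (γ - 1) x) *
              ENNReal.ofReal (wgt a b (β - 1) (γ - 1) x)) ^ (1 / 2 : ℝ) := by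
          rw [← enorm_mul, ← ENNReal.ofReal_mul (by positivity), mul_assoc, ← sq, ← mul_pow,
            ENNReal.ofReal_rpow_of_nonneg (by positivity) (by norm_num), ← Real.sqrt_eq_rpow,
            Real.sqrt_sq_eq_abs, Real.enorm_eq_ofReal_abs]
        rw [hconv f x hx, enorm_mul, enorm_mul, mul_right_comm, hsq, ← mul_assoc,
          ENNReal.mul_rpow_of_nonneg _ (dualNormSq a b β γ θ x) (by norm_num), mul_left_comm]
        gcongr
        exact enorm_integral_mul_le hx hθ hf.1
    _ ≤ F * ((∫⁻ x in Ioo a b, ENNReal.ofReal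
            (jacobiP a b (β - 1) (γ - 1) m x ^ 2 * wgt a b (β - 1) (γ - 1) x)) ^ (1 / 2 : ℝ) *
          S ^ (1 / 2 : ℝ)) := by
        rw [lintegral_const_mul' _ _ hFtop]
        gcongr
        exact lintegral_sqrt_mul_le (by fun_prop) (by fun_prop)
    _ ≤ _ := by
        rw [mul_comm]
        gcongr
        exact hN m
end

section
/- Let a < b be real numbers, I' = (0, b-a), let ϑ ∈ L¹(I'), and let p : ℝ → ℝ be a polynomial. Then for every x ∈ [a,b]: ∫_a^x ϑ(x-t) p(t) dt = ∫_a^x [ p(a) ϑ(s-a) + ∫_a^s ϑ(s-t) p'(t) dt ] ds. In particular the function x ↦ ∫_a^x ϑ(x-t) p(t) dt is absolutely continuous on [a,b] and its derivative equals p(a) ϑ(x-a) + ∫_a^x ϑ(x-t) p'(t) dt for almost every x ∈ (a,b). -/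
open MeasureTheory Set Filter

section TruncatedConvolution

variable {a x : ℝ} {f p q : ℝ → ℝ}

/-- Reflecting the variable in a truncated convolution. -/
theorem intervalIntegral_convolution_comm (f p : ℝ → ℝ) (a x : ℝ) :
    ∫ t in a..x, f (x - t) * p t = ∫ u in (0 : ℝ)..(x - a), f u * p (x - u) := by
  have h := intervalIntegral.integral_comp_sub_left (a := a) (b := x)
    (fun u => f u * p (x - u)) x
  simpa using h

/-- The product `f u * q (s - u)`, cut off outside `u ∈ (0, x - a]` and `s - u ∈ [a, x]`,
is integrable in `(s, u)`. -/
theorem integrable_truncated_convolution_integrand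
    (hf : IntegrableOn f (Ioc 0 (x - a))) (hq : Continuous q) :
    Integrable (fun z : ℝ × ℝ => (Ioc 0 (x - a)).indicator f z.2 *
      (Icc a x).indicator q (z.1 - z.2)) ((volume.restrict (Ioc a x)).prod volume) := by
  have hf' : Integrable ((Ioc 0 (x - a)).indicator f) := hf.integrable_indicator measurableSet_Ioc
  have hq' : Integrable ((Icc a x).indicator q) :=
    hq.integrableOn_Icc.integrable_indicator measurableSet_Icc
  have h := hf'.convolution_integrand (ContinuousLinearMap.mul ℝ ℝ) hq'
  exact h.mono_measure (Measure.prod_mono Measure.restrict_le_self le_rfl)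

/-- On `(a, x]` the truncated convolution is obtained by integrating the cut-off product. -/
theorem integral_truncated_convolution_integrand {s : ℝ} (hs : s ∈ Ioc a x) :
    ∫ u, (Ioc 0 (x - a)).indicator f u * (Icc a x).indicator q (s - u) =
      ∫ t in a..s, f (s - t) * q t := by
  rw [intervalIntegral_convolution_comm,
    intervalIntegral.integral_of_le (sub_nonneg.2 hs.1.le), ← integral_indicator measurableSet_Ioc]
  refine integral_congr_ae (Eventually.of_forall fun u => ?_)
  have := hs.1
  have := hs.2
  simp only [indicator_apply, mem_Ioc, mem_Icc]
  grind

/-- The truncated convolution of an integrable function with a continuous one is integrable. -/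
theorem intervalIntegrable_truncated_convolution (hax : a ≤ x)
    (hf : IntegrableOn f (Ioc 0 (x - a))) (hq : Continuous q) :
    IntervalIntegrable (fun s => ∫ t in a..s, f (s - t) * q t) volume a x := by
  rw [intervalIntegrable_iff_integrableOn_Ioc_of_le hax]
  refine (integrable_truncated_convolution_integrand hf hq).integral_prod_left.congr ?_
  filter_upwards [ae_restrict_mem measurableSet_Ioc] with s hs
  exact integral_truncated_convolution_integrand hs

/-- Fubini's theorem for the integral of a truncated convolution against a derivative. -/
theorem integral_truncated_convolution_deriv (hax : a ≤ x)
    (hf : IntegrableOn f (Ioc 0 (x - a))) (hq : Continuous q) (hp : ∀ y, HasDerivAt p (q y) y) :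
    ∫ s in a..x, ∫ t in a..s, f (s - t) * q t =
      ∫ u in (0 : ℝ)..(x - a), f u * (p (x - u) - p a) := by
  have hswap := integral_integral_swap (μ := volume.restrict (Ioc a x)) (ν := volume)
    (f := fun s u => (Ioc 0 (x - a)).indicator f u * (Icc a x).indicator q (s - u))
    (integrable_truncated_convolution_integrand hf hq)
  rw [intervalIntegral.integral_of_le hax, intervalIntegral.integral_of_le (sub_nonneg.2 hax),
    ← integral_indicator measurableSet_Ioc (f := fun u => f u * (p (x - u) - p a))]
  rw [setIntegral_congr_fun measurableSet_Ioc
    (fun s hs => integral_truncated_convolution_integrand hs)] at hswap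
  rw [hswap]
  refine integral_congr_ae (Eventually.of_forall fun u => ?_)
  simp only [integral_const_mul]
  by_cases hu : u ∈ Ioc 0 (x - a)
  · have hux : a + u ≤ x := by linarith [hu.2]
    have hinner : ∫ s in Ioc a x, (Icc a x).indicator q (s - u) = p (x - u) - p a := by
      calc ∫ s in Ioc a x, (Icc a x).indicator q (s - u)
          = ∫ s in Ioc a x, (Icc (a + u) x).indicator (fun s => q (s - u)) s := by
            refine setIntegral_congr_fun measurableSet_Ioc fun s hs => ?_
            have := hs.2
            have := hu.1
            simp only [indicator_apply, mem_Icc]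
            grind
        _ = ∫ s in (a + u)..x, q (s - u) := by
            have hsub : Icc (a + u) x ⊆ Ioc a x := fun s hs =>
              ⟨by linarith [hs.1, hu.1], hs.2⟩
            rw [setIntegral_indicator measurableSet_Icc, inter_eq_right.2 hsub,
              integral_Icc_eq_integral_Ioc, intervalIntegral.integral_of_le hux]
        _ = p (x - u) - p a := by
            rw [intervalIntegral.integral_comp_sub_right, add_sub_cancel_right]
            exact intervalIntegral.integral_eq_sub_of_hasDerivAt (fun y _ => hp y)
              (hq.intervalIntegrable _ _)
    rw [indicator_of_mem hu, indicator_of_mem hu, hinner]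
  · rw [indicator_of_notMem hu, indicator_of_notMem hu, zero_mul]

/-- The density of a truncated convolution with a `C¹` function is integrable. -/
theorem intervalIntegrable_truncated_convolution_density (hax : a ≤ x)
    (hf : IntegrableOn f (Ioc 0 (x - a))) (hq : Continuous q) (c : ℝ) :
    IntervalIntegrable (fun s => c * f (s - a) + ∫ t in a..s, f (s - t) * q t) volume a x := by
  have hf' : IntervalIntegrable f volume 0 (x - a) :=
    (intervalIntegrable_iff_integrableOn_Ioc_of_le (sub_nonneg.2 hax)).2 hf
  have hshift : IntervalIntegrable (fun s => f (s - a)) volume a x := by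
    simpa using hf'.comp_sub_right a
  exact (hshift.const_mul c).add (intervalIntegrable_truncated_convolution hax hf hq)

/-- A truncated convolution with a `C¹` function is the integral of its formal derivative. -/
theorem truncated_convolution_eq_integral (hax : a ≤ x)
    (hf : IntegrableOn f (Ioc 0 (x - a))) (hq : Continuous q) (hp : ∀ y, HasDerivAt p (q y) y) :
    ∫ t in a..x, f (x - t) * p t =
      ∫ s in a..x, (p a * f (s - a) + ∫ t in a..s, f (s - t) * q t) := by
  have hf' : IntervalIntegrable f volume 0 (x - a) :=
    (intervalIntegrable_iff_integrableOn_Ioc_of_le (sub_nonneg.2 hax)).2 hf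
  have hshift : IntervalIntegrable (fun s => f (s - a)) volume a x := by
    simpa using hf'.comp_sub_right a
  have hpc : Continuous p := continuous_iff_continuousAt.2 fun y => (hp y).continuousAt
  rw [intervalIntegral.integral_add (hshift.const_mul _)
      (intervalIntegrable_truncated_convolution hax hf hq),
    integral_truncated_convolution_deriv hax hf hq hp, intervalIntegral.integral_const_mul,
    intervalIntegral.integral_comp_sub_right, sub_self, ← intervalIntegral.integral_const_mul,
    ← intervalIntegral.integral_add (hf'.const_mul _)
      (hf'.mul_continuousOn (by fun_prop)), intervalIntegral_convolution_comm]
  exact intervalIntegral.integral_congr fun u _ => by ring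

end TruncatedConvolution

/-- formula (4): the Sonin integral of a polynomial is absolutely
continuous, with explicit a.e. derivative `p(a) ϑ(x-a) + ∫_a^x ϑ(x-t) p'(t) dt`. -/
theorem sonin_integral_of_polynomial
    (a b : ℝ) (ϑ : ℝ → ℝ) (P : Polynomial ℝ)
    (hab : a < b)
    (hϑ1 : IntegrableOn ϑ (Ioo 0 (b - a))) :
    (∀ x ∈ Icc a b,
      (∫ t in a..x, ϑ (x - t) * P.eval t) =
        ∫ s in a..x, (P.eval a * ϑ (s - a) +
          ∫ t in a..s, ϑ (s - t) * (Polynomial.derivative P).eval t)) ∧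
    (∀ᵐ x ∂(volume.restrict (Ioo a b)),
      HasDerivAt (fun y => ∫ t in a..y, ϑ (y - t) * P.eval t)
        (P.eval a * ϑ (x - a) +
          ∫ t in a..x, ϑ (x - t) * (Polynomial.derivative P).eval t) x) := by
  have hϑ : IntegrableOn ϑ (Ioc 0 (b - a)) := (integrableOn_Ioc_iff_integrableOn_Ioo (by simp)).2 hϑ1
  have hq : Continuous fun t => (Polynomial.derivative P).eval t :=
    (Polynomial.derivative P).continuous
  have heq : ∀ x ∈ Icc a b, _ := fun x hx => truncated_convolution_eq_integral hx.1
    (hϑ.mono_set (Ioc_subset_Ioc_right (sub_le_sub_right hx.2 a))) hq P.hasDerivAt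
  refine ⟨heq, ?_⟩
  rw [ae_restrict_iff' measurableSet_Ioo]
  filter_upwards [(intervalIntegrable_truncated_convolution_density hab.le hϑ hq
    (P.eval a)).ae_hasDerivAt_integral] with x hx hxab
  refine (hx (Icc_subset_uIcc (Ioo_subset_Icc_self hxab)) a left_mem_uIcc).congr_of_eventuallyEq ?_
  filter_upwards [Icc_mem_nhds hxab.1 hxab.2] with y hy using heq y hy
end

section
/- Let L > 0, let 0 < β < 1 with β ≤ γ, and let δ₁, δ₂ > 0 satisfy δ₁ + β ≤ 1 and δ₂ ≤ γ; set k = δ₁ + δ₂. Then there exists a constant C such that for every t ∈ (0, L): t^k · ∫_t^L x^{β-1} (L-x)^{γ-1} (x-t)^{-β} (L-x+t)^{-γ} dx ≤ C. -/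
open MeasureTheory Set

lemma rpow_le_of_half_le_of_le (c : ℝ) {s v : ℝ} (hs : 0 < s) (h1 : s / 2 ≤ v) (h2 : v ≤ s) :
    v ^ c ≤ (1 + 2 ^ (-c)) * s ^ c := by
  have hv : 0 < v := by linarith
  have h2c : (0 : ℝ) < 2 ^ (-c) := by positivity
  have hsc : 0 < s ^ c := by positivity
  rcases le_total 0 c with hc | hc
  · have := Real.rpow_le_rpow hv.le h2 hc
    nlinarith [mul_pos h2c hsc]
  · have h := Real.rpow_le_rpow_of_nonpos (by positivity : 0 < s / 2) h1 hc
    have h' : (s / 2) ^ c = 2 ^ (-c) * s ^ c := by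
      rw [Real.div_rpow hs.le zero_le_two, Real.rpow_neg zero_le_two]
      ring
    nlinarith

lemma lintegral_rpow_sub_left {a : ℝ} (ha : 0 < a) {t L : ℝ} (htL : t < L) :
    ∫⁻ x in Ioo t L, ENNReal.ofReal ((x - t) ^ (a - 1)) =
      ENNReal.ofReal ((L - t) ^ a / a) := by
  have hi : IntervalIntegrable (fun x : ℝ => (x - t) ^ (a - 1)) volume t L := by
    have := (intervalIntegral.intervalIntegrable_rpow' (a := 0) (b := L - t)
      (by linarith : -1 < a - 1)).comp_sub_right t
    simpa using this
  have hv : ∫ x in t..L, (x - t) ^ (a - 1) = (L - t) ^ a / a := by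
    rw [intervalIntegral.integral_comp_sub_right (fun x => x ^ (a - 1)),
      integral_rpow (Or.inl (by linarith))]
    simp [ha.ne']
  rw [← hv, intervalIntegral.integral_of_le htL.le, integral_Ioc_eq_integral_Ioo,
    ofReal_integral_eq_lintegral_ofReal]
  · exact (intervalIntegrable_iff_integrableOn_Ioo_of_le htL.le).1 hi
  · filter_upwards [ae_restrict_mem measurableSet_Ioo] with x hx
    exact Real.rpow_nonneg (by linarith [hx.1]) _

lemma lintegral_rpow_sub_right {a : ℝ} (ha : 0 < a) {t L : ℝ} (htL : t < L) :
    ∫⁻ x in Ioo t L, ENNReal.ofReal ((L - x) ^ (a - 1)) =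
      ENNReal.ofReal ((L - t) ^ a / a) := by
  have hi : IntervalIntegrable (fun x : ℝ => (L - x) ^ (a - 1)) volume t L := by
    have := (intervalIntegral.intervalIntegrable_rpow' (a := L - t) (b := 0)
      (by linarith : -1 < a - 1)).comp_sub_left L
    simpa using this
  have hv : ∫ x in t..L, (L - x) ^ (a - 1) = (L - t) ^ a / a := by
    rw [intervalIntegral.integral_comp_sub_left (fun x => x ^ (a - 1)),
      integral_rpow (Or.inl (by linarith))]
    simp [ha.ne']
  rw [← hv, intervalIntegral.integral_of_le htL.le, integral_Ioc_eq_integral_Ioo,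
    ofReal_integral_eq_lintegral_ofReal]
  · exact (intervalIntegrable_iff_integrableOn_Ioo_of_le htL.le).1 hi
  · filter_upwards [ae_restrict_mem measurableSet_Ioo] with x hx
    exact Real.rpow_nonneg (by linarith [hx.2]) _

/-- A scaled Beta integral is at most a constant times `(L - t) ^ (a + b - 1)`. -/
lemma exists_lintegral_rpow_mul_rpow_le {a b : ℝ} (ha : 0 < a) (hb : 0 < b) :
    ∃ K : ℝ, 0 ≤ K ∧ ∀ t L : ℝ, t < L →
      ∫⁻ x in Ioo t L, ENNReal.ofReal ((x - t) ^ (a - 1) * (L - x) ^ (b - 1)) ≤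
        ENNReal.ofReal (K * (L - t) ^ (a + b - 1)) := by
  set A : ℝ := 1 + 2 ^ (-(a - 1))
  set B : ℝ := 1 + 2 ^ (-(b - 1))
  have hA0 : 0 < A := by positivity
  have hB0 : 0 < B := by positivity
  refine ⟨B / a + A / b, by positivity, fun t L htL => ?_⟩
  have hs : 0 < L - t := sub_pos.2 htL
  have hsa : 0 < (L - t) ^ (a - 1) := by positivity
  have hsb : 0 < (L - t) ^ (b - 1) := by positivity
  calc
    _ ≤ ∫⁻ x in Ioo t L,
        (ENNReal.ofReal (B * (L - t) ^ (b - 1)) * ENNReal.ofReal ((x - t) ^ (a - 1)) +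
          ENNReal.ofReal (A * (L - t) ^ (a - 1)) * ENNReal.ofReal ((L - x) ^ (b - 1))) := by
      refine setLIntegral_mono' measurableSet_Ioo fun x hx => ?_
      have hu : 0 < x - t := sub_pos.2 hx.1
      have hv : 0 < L - x := sub_pos.2 hx.2
      have hua : 0 < (x - t) ^ (a - 1) := by positivity
      have hvb : 0 < (L - x) ^ (b - 1) := by positivity
      rw [← ENNReal.ofReal_mul (by positivity), ← ENNReal.ofReal_mul (by positivity),
        ← ENNReal.ofReal_add (by positivity) (by positivity)]
      refine ENNReal.ofReal_le_ofReal ?_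
      have h1 : 0 < B * (L - t) ^ (b - 1) * (x - t) ^ (a - 1) := by positivity
      have h2 : 0 < A * (L - t) ^ (a - 1) * (L - x) ^ (b - 1) := by positivity
      rcases le_total (x - t) (L - x) with h | h
      · have := rpow_le_of_half_le_of_le (b - 1) hs (v := L - x) (by linarith) (by linarith)
        nlinarith [mul_le_mul_of_nonneg_left this hua.le]
      · have := rpow_le_of_half_le_of_le (a - 1) hs (v := x - t) (by linarith) (by linarith)
        nlinarith [mul_le_mul_of_nonneg_left this hvb.le]
    _ = ENNReal.ofReal (B * (L - t) ^ (b - 1)) * ENNReal.ofReal ((L - t) ^ a / a) +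
          ENNReal.ofReal (A * (L - t) ^ (a - 1)) * ENNReal.ofReal ((L - t) ^ b / b) := by
      rw [lintegral_add_left (by fun_prop), lintegral_const_mul' _ _ ENNReal.ofReal_ne_top,
        lintegral_const_mul' _ _ ENNReal.ofReal_ne_top, lintegral_rpow_sub_left ha htL,
        lintegral_rpow_sub_right hb htL]
    _ = _ := by
      rw [← ENNReal.ofReal_mul (by positivity), ← ENNReal.ofReal_mul (by positivity),
        ← ENNReal.ofReal_add (by positivity) (by positivity)]
      have h1 : (L - t) ^ (a + b - 1) = (L - t) ^ (b - 1) * (L - t) ^ a := by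
        rw [← Real.rpow_add hs]; ring_nf
      have h2 : (L - t) ^ (a + b - 1) = (L - t) ^ (a - 1) * (L - t) ^ b := by
        rw [← Real.rpow_add hs]; ring_nf
      congr 1
      linear_combination -(B / a) * h1 - (A / b) * h2

lemma rpow_mul_rpow_le_rpow_add {t u v d c : ℝ} (ht : 0 < t) (hu : 0 < u) (htv : t ≤ v)
    (huv : u ≤ v) (hd : 0 ≤ d) (hdc : d + c ≤ 0) : t ^ d * v ^ c ≤ u ^ (d + c) := by
  have hv : 0 < v := ht.trans_le htv
  calc t ^ d * v ^ c ≤ v ^ d * v ^ c := by gcongr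
    _ = v ^ (d + c) := (Real.rpow_add hv _ _).symm
    _ ≤ u ^ (d + c) := Real.rpow_le_rpow_of_nonpos hu huv hdc

/-- the key uniform weight estimate of Lemma 2:
`t^k ∫_t^L x^{β-1}(L-x)^{γ-1}(x-t)^{-β}(L-x+t)^{-γ} dx ≤ C` uniformly in `t ∈ (0,L)`. -/
theorem weight_convolution_bound_shifted
    (L β γ δ₁ δ₂ : ℝ) (hL : 0 < L)
    (hβ0 : 0 < β) (hβ1 : β < 1) (hβγ : β ≤ γ)
    (hδ₁ : 0 < δ₁) (hδ₂ : 0 < δ₂) (hδ₁β : δ₁ + β ≤ 1) (hδ₂γ : δ₂ ≤ γ) :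
    ∃ C : ℝ, ∀ t ∈ Ioo (0 : ℝ) L,
      ENNReal.ofReal (t ^ (δ₁ + δ₂)) *
        ∫⁻ x in Ioo t L, ENNReal.ofReal
          (x ^ (β - 1) * (L - x) ^ (γ - 1) * (x - t) ^ (-β) * (L - x + t) ^ (-γ)) ≤
      ENNReal.ofReal C := by
  obtain ⟨K₁, hK₁, H₁⟩ := exists_lintegral_rpow_mul_rpow_le hδ₁ hδ₂
  obtain ⟨K₂, hK₂, H₂⟩ :=
    exists_lintegral_rpow_mul_rpow_le (sub_pos.2 hβ1) (hβ0.trans_le hβγ)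
  set M : ℝ := L ^ (δ₁ + δ₂) * (L / 2) ^ (β - 1) * (L / 2) ^ (-γ) with hM
  have hM0 : 0 ≤ M := by positivity
  refine ⟨max (K₁ * ((1 + 2 ^ (-(δ₁ + δ₂ - 1))) * L ^ (δ₁ + δ₂ - 1)))
    (M * (K₂ * L ^ (1 - β + γ - 1))), fun t ht => ?_⟩
  obtain ⟨ht0, htL⟩ := ht
  rw [← lintegral_const_mul' _ _ ENNReal.ofReal_ne_top]
  rcases le_total t (L / 2) with h | h
  · refine (setLIntegral_mono' measurableSet_Ioo fun x hx => ?_).trans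
      ((H₁ t L htL).trans (ENNReal.ofReal_le_ofReal (le_max_of_le_left ?_)))
    · have hu : 0 < x - t := sub_pos.2 hx.1
      have hv : 0 < L - x := sub_pos.2 hx.2
      have hx0 : 0 < x := ht0.trans hx.1
      rw [← ENNReal.ofReal_mul (by positivity)]
      refine ENNReal.ofReal_le_ofReal ?_
      have h1 := rpow_mul_rpow_le_rpow_add (c := β - 1) ht0 hu hx.1.le (by linarith) hδ₁.le
        (by linarith)
      have h2 := rpow_mul_rpow_le_rpow_add (v := L - x + t) (c := -γ) ht0 hv (by linarith)
        (by linarith) hδ₂.le (by linarith)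
      calc t ^ (δ₁ + δ₂) *
            (x ^ (β - 1) * (L - x) ^ (γ - 1) * (x - t) ^ (-β) * (L - x + t) ^ (-γ))
          = (t ^ δ₁ * x ^ (β - 1)) * (t ^ δ₂ * (L - x + t) ^ (-γ)) *
              ((x - t) ^ (-β) * (L - x) ^ (γ - 1)) := by
            rw [Real.rpow_add ht0]; ring
        _ ≤ (x - t) ^ (δ₁ + (β - 1)) * (L - x) ^ (δ₂ + -γ) *
              ((x - t) ^ (-β) * (L - x) ^ (γ - 1)) := by gcongr
        _ = ((x - t) ^ (δ₁ + (β - 1)) * (x - t) ^ (-β)) *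
              ((L - x) ^ (δ₂ + -γ) * (L - x) ^ (γ - 1)) := by ring
        _ = (x - t) ^ (δ₁ - 1) * (L - x) ^ (δ₂ - 1) := by
            rw [← Real.rpow_add hu, ← Real.rpow_add hv]
            ring_nf
    · gcongr
      exact rpow_le_of_half_le_of_le _ hL (by linarith) (by linarith)
  · calc
      _ ≤ ∫⁻ x in Ioo t L, ENNReal.ofReal M *
            ENNReal.ofReal ((x - t) ^ (1 - β - 1) * (L - x) ^ (γ - 1)) := by
        refine setLIntegral_mono' measurableSet_Ioo fun x hx => ?_
        have hu : 0 < x - t := sub_pos.2 hx.1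
        have hv : 0 < L - x := sub_pos.2 hx.2
        have hx0 : 0 < x := ht0.trans hx.1
        rw [← ENNReal.ofReal_mul (by positivity), ← ENNReal.ofReal_mul hM0]
        refine ENNReal.ofReal_le_ofReal ?_
        have h1 : x ^ (β - 1) ≤ (L / 2) ^ (β - 1) :=
          Real.rpow_le_rpow_of_nonpos (by positivity) (by linarith) (by linarith)
        have h2 : (L - x + t) ^ (-γ) ≤ (L / 2) ^ (-γ) :=
          Real.rpow_le_rpow_of_nonpos (by positivity) (by linarith) (by linarith)
        calc t ^ (δ₁ + δ₂) *
              (x ^ (β - 1) * (L - x) ^ (γ - 1) * (x - t) ^ (-β) * (L - x + t) ^ (-γ))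
            = t ^ (δ₁ + δ₂) * x ^ (β - 1) * (L - x + t) ^ (-γ) *
                ((x - t) ^ (1 - β - 1) * (L - x) ^ (γ - 1)) := by ring_nf
          _ ≤ M * ((x - t) ^ (1 - β - 1) * (L - x) ^ (γ - 1)) := by
            rw [hM]; gcongr
      _ ≤ ENNReal.ofReal M * ENNReal.ofReal (K₂ * (L - t) ^ (1 - β + γ - 1)) := by
        rw [lintegral_const_mul' _ _ ENNReal.ofReal_ne_top]
        gcongr
        exact H₂ t L htL
      _ ≤ _ := by
        rw [← ENNReal.ofReal_mul hM0]
        refine ENNReal.ofReal_le_ofReal (le_max_of_le_right ?_)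
        have hs : 0 ≤ L - t := by linarith
        have he : 0 ≤ 1 - β + γ - 1 := by linarith
        gcongr
        linarith
end

section
/- Let a < b be real numbers, I = (a,b), I' = (0, b-a), and let ϱ, ϑ ∈ L¹(I') satisfy the Sonin condition. Let η be a smooth function compactly supported in (a,b). Then for almost every x ∈ (a,b): ∫_x^b ϱ(t-x) ( -∫_t^b ϑ(s-t) η'(s) ds ) dt = η(x); that is, writing (D^ϑ_{b-}η)(t) = -∫_t^b ϑ(s-t) η'(s) ds for the right-sided generalized derivative, one has I^ϱ_{b-} D^ϑ_{b-} η = η a.e., where (I^ϱ_{b-}g)(x) = ∫_x^b ϱ(t-x) g(t) dt. -/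
open MeasureTheory Set Filter

/-- Convolving the extensions by zero of two functions on `(0, L)` gives, at `w < L`, the
truncated convolution over `(0, w)`. -/
theorem integral_indicator_Ioo_mul_indicator_Ioo (f g : ℝ → ℝ) {L w : ℝ} (hw : w < L) :
    ∫ t, (Ioo 0 L).indicator f (w - t) * (Ioo 0 L).indicator g t =
      ∫ t in Ioo 0 w, f (w - t) * g t := by
  rw [← integral_indicator measurableSet_Ioo]
  refine integral_congr_ae (Eventually.of_forall fun t => ?_)
  simp only [indicator_apply, mem_Ioo]
  by_cases h0 : 0 < t <;> by_cases h1 : t < w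
  · rw [if_pos ⟨by linarith, by linarith⟩, if_pos ⟨h0, by linarith⟩, if_pos ⟨h0, h1⟩]
  · rw [if_neg (fun h => h1 (by linarith [h.1])), zero_mul, if_neg (fun h => h1 h.2)]
  · rw [if_neg (c := 0 < t ∧ t < L) (fun h => h0 h.1), mul_zero, if_neg (fun h => h0 h.1)]
  · rw [if_neg (c := 0 < t ∧ t < L) (fun h => h0 h.1), mul_zero, if_neg (fun h => h0 h.1)]

/-- Fubini for a convolution of integrable functions tested against a bounded function. -/
theorem integral_mul_integral_mul_eq_integral_convolution_mul {f k g : ℝ → ℝ} {C : ℝ}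
    (hf : Integrable f) (hk : Integrable k) (hg : AEStronglyMeasurable g)
    (hC : ∀ s, ‖g s‖ ≤ C) :
    ∫ t, f t * ∫ s, k (s - t) * g s = ∫ s, (∫ t, f (s - t) * k t) * g s := by
  have h1 : Integrable (fun p : ℝ × ℝ => f p.2 * k (p.1 - p.2)) (volume.prod volume) := by
    simpa using hf.convolution_integrand (ContinuousLinearMap.mul ℝ ℝ) hk
  have h2 : Integrable (fun p : ℝ × ℝ => f p.2 * k (p.1 - p.2) * g p.1)
      (volume.prod volume) :=
    h1.mul_bdd hg.comp_fst (Eventually.of_forall fun p => hC p.1)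
  calc ∫ t, f t * ∫ s, k (s - t) * g s = ∫ t, ∫ s, f t * k (s - t) * g s := by
        simp only [← integral_const_mul, mul_assoc]
    _ = ∫ s, ∫ t, f t * k (s - t) * g s := (integral_integral_swap h2).symm
    _ = ∫ s, (∫ t, f (s - t) * k t) * g s := by
        congr 1 with s
        rw [integral_mul_const, ← integral_sub_left_eq_self _ volume s]
        simp only [sub_sub_cancel]

/-- `I^ϱ_{b-} D^ϑ_{b-} η = η` a.e. for smooth `η` compactly supported
in `(a,b)`. -/
theorem sonin_right_inverse_smooth
    (a b : ℝ) (ϱ ϑ η : ℝ → ℝ)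
    (hab : a < b)
    (hϱ1 : IntegrableOn ϱ (Ioo 0 (b - a)))
    (hϑ1 : IntegrableOn ϑ (Ioo 0 (b - a)))
    (hson : SoninCond a b ϱ ϑ)
    (hη : ContDiff ℝ (⊤ : ℕ∞) η) (hηsupp : HasCompactSupport η)
    (hηsub : tsupport η ⊆ Ioo a b) :
    ∀ᵐ x ∂(volume.restrict (Ioo a b)),
      (∫ t in x..b, ϱ (t - x) * (-(∫ s in t..b, ϑ (s - t) * deriv η s))) = η x := by
  have hd : Continuous (deriv η) := hη.continuous_deriv (by simp)
  obtain ⟨C, hC⟩ := hd.bounded_above_of_compact_support hηsupp.deriv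
  have hη0 : ∀ s, b ≤ s → η s = 0 := fun s hs =>
    image_eq_zero_of_notMem_tsupport fun h => absurd (hηsub h).2 (not_lt.2 hs)
  have hd0 : ∀ s, b ≤ s → deriv η s = 0 := fun s hs => by
    by_contra h
    exact absurd (hηsub (support_deriv_subset (Function.mem_support.2 h))).2 (not_lt.2 hs)
  refine (ae_restrict_iff' measurableSet_Ioo).2 (Eventually.of_forall fun x hx => ?_)
  set R := (Ioo 0 (b - a)).indicator ϱ with hR
  set T := (Ioo 0 (b - a)).indicator ϑ with hT
  have hRi : Integrable R := (integrable_indicator_iff measurableSet_Ioo).2 hϱ1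
  have hTi : Integrable T := (integrable_indicator_iff measurableSet_Ioo).2 hϑ1
  have h_inner : ∀ t, x < t → t < b →
      ∫ s in t..b, ϑ (s - t) * deriv η s = ∫ s, T (s - t) * deriv η s := by
    intro t ht htb
    rw [intervalIntegral.integral_of_le htb.le, integral_Ioc_eq_integral_Ioo,
      ← integral_indicator measurableSet_Ioo]
    refine integral_congr_ae (Eventually.of_forall fun s => ?_)
    simp only [hT, indicator_apply, mem_Ioo]
    rcases le_or_gt b s with h | h
    · simp [hd0 s h]
    · by_cases h' : t < s
      · rw [if_pos ⟨h', h⟩, if_pos ⟨by linarith, by linarith [hx.1]⟩]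
      · rw [if_neg fun h => h' h.1, if_neg fun h => h' (by linarith [h.1]), zero_mul]
  have h_zero : ∀ t, b ≤ t → ∫ s, T (s - t) * deriv η s = 0 := by
    intro t ht
    refine integral_eq_zero_of_ae (Eventually.of_forall fun s => ?_)
    rcases le_or_gt b s with h | h
    · simp [hd0 s h]
    · simp [hT, not_lt.2 (h.le.trans ht)]
  have h_outer : ∫ t in x..b, ϱ (t - x) * (-(∫ s in t..b, ϑ (s - t) * deriv η s)) =
      -∫ t, R (t - x) * ∫ s, T (s - t) * deriv η s := by
    rw [intervalIntegral.integral_of_le hx.2.le, integral_Ioc_eq_integral_Ioo,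
      ← integral_indicator measurableSet_Ioo, ← integral_neg]
    refine integral_congr_ae (Eventually.of_forall fun t => ?_)
    simp only [indicator_apply, mem_Ioo]
    rcases le_or_gt b t with h | h
    · rw [h_zero t h, if_neg fun h' => not_lt.2 h h'.2, mul_zero, neg_zero]
    · by_cases h' : x < t
      · rw [if_pos ⟨h', h⟩, h_inner t h' h, hR,
          indicator_of_mem (by constructor <;> linarith [hx.1]), mul_neg]
      · rw [if_neg fun h => h' h.1, hR,
          indicator_of_notMem fun h => h' (by linarith [h.1]), zero_mul, neg_zero]
  have h_conv : ∀ᵐ s, (∫ t, R (s - t - x) * T t) * deriv η s =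
      (Ioo x b).indicator (deriv η) s := by
    have hson' := (measurePreserving_sub_right volume x).quasiMeasurePreserving.ae
      ((ae_restrict_iff' measurableSet_Ioo).1 hson)
    filter_upwards [hson'] with s hs
    rcases le_or_gt b s with h | h
    · simp [hd0 s h, indicator_apply]
    · simp only [sub_right_comm s _ x]
      rw [integral_indicator_Ioo_mul_indicator_Ioo _ _ (by linarith [hx.1])]
      by_cases h' : x < s
      · have h1 := hs ⟨by linarith, by linarith [hx.1]⟩
        rw [intervalIntegral.integral_of_le (by linarith), integral_Ioc_eq_integral_Ioo] at h1
        rw [h1, one_mul, indicator_of_mem (mem_Ioo.2 ⟨h', h⟩)]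
      · rw [Ioo_eq_empty (by linarith), indicator_of_notMem fun h => h' h.1]
        simp
  rw [h_outer, integral_mul_integral_mul_eq_integral_convolution_mul (hRi.comp_sub_right x) hTi
    hd.aestronglyMeasurable hC, integral_congr_ae h_conv, integral_indicator measurableSet_Ioo,
    ← integral_Ioc_eq_integral_Ioo, ← intervalIntegral.integral_of_le hx.2.le,
    intervalIntegral.integral_deriv_eq_sub (fun s _ => hη.differentiable (by simp) s)
      (hd.intervalIntegrable _ _), hη0 b le_rfl]
  ring
end
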